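/- arXiv:1503.04826 — 2 statements merged into one kernel-verified Lean document; each statement's English description precedes it below -/
import Mathlib

section
/- There exists a constant C > 0 such that for every 0 < ε < 1, every coordinate index i ∈ {1,…,d}, and every x ∈ ℝ^d with x_i > 2, |∂_{x_i} K_ε(x) − ∂_{x_i} K(x)| ≤ C ε |x|^{q−2}. -/
open MeasureTheory Filter
open scoped ENNReal Topology NNReal

noncomputable section

/-- Power-law interaction kernel `K(x) = |x|^q/q - |x|^p/p` (real-valued). -/
noncomputable def Kfun (d : ℕ) (p q : ℝ) (x : EuclideanSpace ℝ (Fin d)) : ℝ :=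
  ‖x‖ ^ q / q - ‖x‖ ^ p / p

/-- Power-law interaction kernel, valued in `[0,∞]` (note `K 0 = ∞` when `p < 0 < q`). -/
noncomputable def KE (d : ℕ) (p q : ℝ) (x : EuclideanSpace ℝ (Fin d)) : ℝ≥0∞ :=
  (‖x‖₊ : ℝ≥0∞) ^ q / ENNReal.ofReal q + (‖x‖₊ : ℝ≥0∞) ^ p / ENNReal.ofReal (-p)

/-- Repulsive part `K^r(x) = -|x|^p/p` of the power-law kernel, valued in `[0,∞]`. -/
noncomputable def KrE (d : ℕ) (p : ℝ) (x : EuclideanSpace ℝ (Fin d)) : ℝ≥0∞ :=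
  (‖x‖₊ : ℝ≥0∞) ^ p / ENNReal.ofReal (-p)

/-- Rescaled mollifier `φ_ε(x) = ε^{-d} φ(x/ε)`. -/
noncomputable def scaled (d : ℕ) (φ : EuclideanSpace ℝ (Fin d) → ℝ) (ε : ℝ)
    (x : EuclideanSpace ℝ (Fin d)) : ℝ :=
  (ε ^ d)⁻¹ * φ (ε⁻¹ • x)

/-- Mollifier hypotheses (M1)–(M3). -/
def IsMollifier (d : ℕ) (φ : EuclideanSpace ℝ (Fin d) → ℝ) : Prop :=
  ContDiff ℝ (⊤ : ℕ∞) φ ∧ (∀ x y, ‖x‖ = ‖y‖ → φ x = φ y) ∧ (∀ x, 0 ≤ φ x) ∧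
    (∫ x, φ x) = 1 ∧
    ∃ C : ℝ, 0 < C ∧ ∃ l : ℝ, max (2 * (d : ℝ) + 1) 4 ≤ l ∧
      ∀ x : EuclideanSpace ℝ (Fin d), x ≠ 0 → φ x ≤ C * ‖x‖ ^ (-l)

/-- Regularized kernel `K_ε = φ_ε * K * φ_ε` (real-valued). -/
noncomputable def Kreg (d : ℕ) (p q : ℝ) (φ : EuclideanSpace ℝ (Fin d) → ℝ) (ε : ℝ)
    (x : EuclideanSpace ℝ (Fin d)) : ℝ :=
  ∫ y, ∫ z, scaled d φ ε y * Kfun d p q (x - y - z) * scaled d φ ε z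

/-- Double mollification `g * K * g` of a `[0,∞]`-valued kernel by a nonnegative function. -/
noncomputable def convE (d : ℕ) (g : EuclideanSpace ℝ (Fin d) → ℝ)
    (K : EuclideanSpace ℝ (Fin d) → ℝ≥0∞) (x : EuclideanSpace ℝ (Fin d)) : ℝ≥0∞ :=
  ∫⁻ y, ∫⁻ z, ENNReal.ofReal (g y) * K (x - y - z) * ENNReal.ofReal (g z)

/-- Interaction energy `E(μ) = ∬ K(x-y) dμ(x) dμ(y)` for a `[0,∞]`-valued kernel. -/
noncomputable def energyE (d : ℕ) (K : EuclideanSpace ℝ (Fin d) → ℝ≥0∞)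
    (μ : Measure (EuclideanSpace ℝ (Fin d))) : ℝ≥0∞ :=
  ∫⁻ x, ∫⁻ y, K (x - y) ∂μ ∂μ

/-- Regularized interaction energy `E_ε(μ) = ∬ K_ε(x-y) dμ(x) dμ(y)`. -/
noncomputable def energyReg (d : ℕ) (p q : ℝ) (φ : EuclideanSpace ℝ (Fin d) → ℝ) (ε : ℝ)
    (μ : Measure (EuclideanSpace ℝ (Fin d))) : ℝ≥0∞ :=
  energyE d (fun x => ENNReal.ofReal (Kreg d p q φ ε x)) μ

/-- Real-valued interaction energy. -/
noncomputable def energyReal (d : ℕ) (p q : ℝ) (μ : Measure (EuclideanSpace ℝ (Fin d))) : ℝ :=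
  ∫ x, ∫ y, Kfun d p q (x - y) ∂μ ∂μ

/-- Borel probability measure with finite second moment. -/
def IsP2 (d : ℕ) (μ : Measure (EuclideanSpace ℝ (Fin d))) : Prop :=
  IsProbabilityMeasure μ ∧ (∫⁻ x, (‖x‖₊ : ℝ≥0∞) ^ 2 ∂μ) < ⊤

/-- The heat kernel `ψ_ε(x) = (4πε)^{-d/2} e^{-|x|²/(4ε)}`. -/
noncomputable def heat (d : ℕ) (ε : ℝ) (x : EuclideanSpace ℝ (Fin d)) : ℝ :=
  (4 * Real.pi * ε) ^ (-(d : ℝ) / 2) * Real.exp (-‖x‖ ^ 2 / (4 * ε))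

/-- Weak-* convergence of a sequence of measures: convergence of integrals of all bounded
continuous functions. -/
def WeakStarTendsto (d : ℕ) (μ : ℕ → Measure (EuclideanSpace ℝ (Fin d)))
    (ν : Measure (EuclideanSpace ℝ (Fin d))) : Prop :=
  ∀ f : EuclideanSpace ℝ (Fin d) → ℝ, Continuous f → (∃ M : ℝ, ∀ x, |f x| ≤ M) →
    Tendsto (fun k => ∫ x, f x ∂(μ k)) atTop (𝓝 (∫ x, f x ∂ν))

/-- `μ` is absolutely continuous (w.r.t. Lebesgue) with density bounded by `R`. -/
def HasBddDensity (d : ℕ) (μ : Measure (EuclideanSpace ℝ (Fin d))) (R : ℝ) : Prop :=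
  ∃ ρ : EuclideanSpace ℝ (Fin d) → ℝ≥0∞, Measurable ρ ∧ μ = volume.withDensity ρ ∧
    ∀ᵐ x ∂(volume : Measure (EuclideanSpace ℝ (Fin d))), ρ x ≤ ENNReal.ofReal R

/-- Explicit gradient `∇K(x) = x|x|^{q-2} - x|x|^{p-2}` of the power-law kernel. -/
noncomputable def gradK (d : ℕ) (p q : ℝ) (x : EuclideanSpace ℝ (Fin d)) :
    EuclideanSpace ℝ (Fin d) :=
  (‖x‖ ^ (q - 2)) • x - (‖x‖ ^ (p - 2)) • x

/-- The log-Lipschitz modulus of convexity `ω`. -/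
noncomputable def omegaMod (x : ℝ) : ℝ :=
  if x ≤ Real.exp (-1 - Real.sqrt 2) then x * |Real.log x|
  else Real.sqrt (x ^ 2 + 2 * (1 + Real.sqrt 2) * Real.exp (-1 - Real.sqrt 2) * x)

/-- Support of a measure: points all of whose neighborhoods have positive measure. -/
def msupport (d : ℕ) (μ : Measure (EuclideanSpace ℝ (Fin d))) :
    Set (EuclideanSpace ℝ (Fin d)) :=
  {x | ∀ r : ℝ, 0 < r → 0 < μ (Metric.ball x r)}

/-- The measure `μ * ψ_δ` obtained by mollifying `μ` with the heat kernel at scale `δ`. -/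
noncomputable def heatMollified (d : ℕ) (μ : Measure (EuclideanSpace ℝ (Fin d))) (δ : ℝ) :
    Measure (EuclideanSpace ℝ (Fin d)) :=
  volume.withDensity fun x => ENNReal.ofReal (∫ y, heat d δ (x - y) ∂μ)

/-! ### Part 1: one-dimensional estimates -/

/-- radial profile -/
def kf (p q r : ℝ) : ℝ := r ^ q / q - r ^ p / p

lemma rpow_sub_le_aux (s a b : ℝ) (ha : 0 < a) (hab : a ≤ b) :
    |b ^ s - a ^ s| ≤ |s| * (b - a) * (a ^ (s - 1) + b ^ (s - 1)) := by
  have hb : 0 < b := ha.trans_le hab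
  have key := (convex_Icc a b).norm_image_sub_le_of_norm_hasDerivWithin_le
    (f := fun t : ℝ => t ^ s) (f' := fun t => s * t ^ (s - 1))
    (C := |s| * (a ^ (s - 1) + b ^ (s - 1))) (x := a) (y := b)
    (fun t ht => (Real.hasDerivAt_rpow_const (Or.inl (ha.trans_le ht.1).ne')).hasDerivWithinAt)
    (fun t ht => by
      have ht0 : 0 < t := ha.trans_le ht.1
      rw [norm_mul, Real.norm_eq_abs, Real.norm_eq_abs, abs_of_pos (Real.rpow_pos_of_pos ht0 _)]
      refine mul_le_mul_of_nonneg_left ?_ (abs_nonneg _)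
      rcases le_total 0 (s - 1) with h | h
      · have := Real.rpow_le_rpow ht0.le ht.2 h
        have := Real.rpow_pos_of_pos ha (s - 1)
        linarith
      · have := Real.rpow_le_rpow_of_nonpos ha ht.1 h
        have := Real.rpow_pos_of_pos hb (s - 1)
        linarith)
    ⟨le_rfl, hab⟩ ⟨hab, le_rfl⟩
  simp only [Real.norm_eq_abs] at key
  rw [abs_of_nonneg (sub_nonneg.2 hab)] at key
  linarith

lemma rpow_sub_le (s a b : ℝ) (ha : 0 < a) (hb : 0 < b) :
    |a ^ s - b ^ s| ≤ |s| * |a - b| * (a ^ (s - 1) + b ^ (s - 1)) := by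
  rcases le_total a b with h | h
  · have := rpow_sub_le_aux s a b ha h
    rw [abs_sub_comm, abs_sub_comm a b, abs_of_nonneg (sub_nonneg.2 h)]
    exact this
  · have := rpow_sub_le_aux s b a hb h
    rw [abs_of_nonneg (sub_nonneg.2 h)]
    linarith

/-- bound for the derivative of the profile -/
def Mf (p q r : ℝ) : ℝ := r ^ (q - 1) + r ^ (p - 1)

lemma kf_sub_le (p q a b : ℝ) (hp : p ≠ 0) (hq : q ≠ 0) (ha : 0 < a) (hb : 0 < b) :
    |kf p q a - kf p q b| ≤ |a - b| * (Mf p q a + Mf p q b) := by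
  have h (s : ℝ) (hs : s ≠ 0) : |a ^ s / s - b ^ s / s| ≤ |a - b| * (a ^ (s - 1) + b ^ (s - 1)) := by
    rw [← sub_div, abs_div, div_le_iff₀ (abs_pos.2 hs)]
    linarith [rpow_sub_le s a b ha hb]
  have e : kf p q a - kf p q b = (a ^ q / q - b ^ q / q) - (a ^ p / p - b ^ p / p) := by
    unfold kf; ring
  rw [e]
  refine (abs_sub _ _).trans ?_
  unfold Mf
  linarith [h q hq, h p hp]

lemma Mf_le_small (p q r : ℝ) (hpq : p ≤ q) (h0 : 0 < r) (h1 : r ≤ 1) :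
    Mf p q r ≤ 2 * r ^ (p - 1) := by
  have := Real.rpow_le_rpow_of_exponent_ge h0 h1 (show p - 1 ≤ q - 1 by linarith)
  unfold Mf; linarith

lemma Mf_le_big (p q r : ℝ) (hp : p < 0) (hq : 0 < q) (h0 : 1 / 2 ≤ r) :
    Mf p q r ≤ (2 + 2 ^ (1 - p)) * (1 + r) ^ q := by
  have hr : 0 < r := by linarith
  have h1 : r ^ (q - 1) ≤ 2 * (1 + r) ^ q := by
    rw [Real.rpow_sub_one hr.ne', div_le_iff₀ hr]
    have h2 : r ^ q ≤ (1 + r) ^ q := Real.rpow_le_rpow hr.le (by linarith) hq.le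
    have h3 : 0 ≤ (1 + r) ^ q := by positivity
    nlinarith
  have h2 : r ^ (p - 1) ≤ 2 ^ (1 - p) := by
    have := Real.rpow_le_rpow_of_nonpos (by norm_num : (0:ℝ) < 1 / 2) h0
      (show p - 1 ≤ 0 by linarith)
    refine this.trans (le_of_eq ?_)
    rw [one_div, Real.inv_rpow (by norm_num), ← Real.rpow_neg (by norm_num)]
    congr 1; ring
  have h3 : 1 ≤ (1 + r) ^ q := Real.one_le_rpow (by linarith) hq.le
  have h4 : 0 < (2:ℝ) ^ (1 - p) := by positivity
  unfold Mf
  nlinarith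

section KernelProof

variable {d : ℕ}

local notation "E" => EuclideanSpace ℝ (Fin d)

/-- singular, compactly supported part -/
def K1 (p q : ℝ) (u : EuclideanSpace ℝ (Fin d)) : ℝ := kf p q (min ‖u‖ (1 / 2)) - kf p q (1 / 2)

/-- regular part -/
def K2 (p q : ℝ) (u : EuclideanSpace ℝ (Fin d)) : ℝ := kf p q (max ‖u‖ (1 / 2))

/-- integrable derivative bound for the singular part -/
def Nf (p : ℝ) (u : EuclideanSpace ℝ (Fin d)) : ℝ :=
  if ‖u‖ < 1 / 2 then 4 * ‖u‖ ^ (p - 1) else 0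

lemma Kfun_eq (p q : ℝ) (u : E) : Kfun d p q u = K1 p q u + K2 p q u := by
  unfold K1 K2
  rcases le_total ‖u‖ (1 / 2) with h | h
  · rw [min_eq_left h, max_eq_right h]; simp [Kfun, kf]
  · rw [min_eq_right h, max_eq_left h]; simp [Kfun, kf]

lemma Nf_nonneg (p : ℝ) (u : E) : 0 ≤ Nf p u := by
  unfold Nf; split_ifs <;> positivity

lemma K1_sub_le (p q : ℝ) (hp : p < 0) (hq : 0 < q) (u v : E) (hu : u ≠ 0) (hv : v ≠ 0) :
    |K1 p q u - K1 p q v| ≤ ‖u - v‖ * (Nf p u + Nf p v) := by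
  have hu' := norm_pos_iff.2 hu
  have hv' := norm_pos_iff.2 hv
  have e : K1 p q u - K1 p q v = kf p q (min ‖u‖ (1 / 2)) - kf p q (min ‖v‖ (1 / 2)) := by
    unfold K1; ring
  have hN := Nf_nonneg p u
  have hN' := Nf_nonneg p v
  set a := min ‖u‖ (1 / 2) with ha
  set b := min ‖v‖ (1 / 2) with hb
  have ha0 : 0 < a := lt_min hu' (by norm_num)
  have hb0 : 0 < b := lt_min hv' (by norm_num)
  have ha1 : a ≤ 1 := (min_le_right _ _).trans (by norm_num)
  have hb1 : b ≤ 1 := (min_le_right _ _).trans (by norm_num)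
  have h1 := kf_sub_le p q a b hp.ne hq.ne' ha0 hb0
  have h2 := Mf_le_small p q a (by linarith) ha0 ha1
  have h3 := Mf_le_small p q b (by linarith) hb0 hb1
  have hab : |a - b| ≤ ‖u - v‖ := by
    have h := abs_min_sub_min_le_max ‖u‖ (1 / 2) ‖v‖ (1 / 2)
    rw [sub_self, abs_zero, max_eq_left (abs_nonneg _)] at h
    exact h.trans (abs_norm_sub_norm_le u v)
  rw [e]
  by_cases hboth : 1 / 2 ≤ ‖u‖ ∧ 1 / 2 ≤ ‖v‖
  · rw [ha, hb, min_eq_right hboth.1, min_eq_right hboth.2, sub_self, abs_zero]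
    positivity
  · refine h1.trans (mul_le_mul hab ?_ ?_ (norm_nonneg _))
    · by_cases c1 : ‖u‖ < 1 / 2 <;> by_cases c2 : ‖v‖ < 1 / 2
      · have ea : a = ‖u‖ := min_eq_left c1.le
        have eb : b = ‖v‖ := min_eq_left c2.le
        simp only [Nf, c1, c2, if_true]
        rw [ea] at h2 ⊢; rw [eb] at h3 ⊢
        have : 0 ≤ ‖u‖ ^ (p - 1) := by positivity
        have : 0 ≤ ‖v‖ ^ (p - 1) := by positivity
        linarith
      · have ea : a = ‖u‖ := min_eq_left c1.le
        have hle : a ≤ b := by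
          rw [hb, min_eq_right (not_lt.1 c2)]; exact min_le_right _ _
        have := Real.rpow_le_rpow_of_nonpos ha0 hle (show p - 1 ≤ 0 by linarith)
        simp only [Nf, c1, c2, if_true, if_false]
        rw [← ea]; linarith
      · have eb : b = ‖v‖ := min_eq_left c2.le
        have hle : b ≤ a := by
          rw [ha, min_eq_right (not_lt.1 c1)]; exact min_le_right _ _
        have := Real.rpow_le_rpow_of_nonpos hb0 hle (show p - 1 ≤ 0 by linarith)
        simp only [Nf, c1, c2, if_true, if_false]
        rw [← eb]; linarith
      · exact absurd ⟨not_lt.1 c1, not_lt.1 c2⟩ hboth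
    · unfold Mf; positivity

lemma K1_eq_zero (p q : ℝ) (u : E) (hu : 1 / 2 ≤ ‖u‖) : K1 p q u = 0 := by
  unfold K1; rw [min_eq_right hu, sub_self]

/-- pointwise bound of the singular part, away from the origin -/
lemma K1_abs_le (p q : ℝ) (hp : p < 0) (hq : 0 < q) (u : E) (hu : u ≠ 0) :
    |K1 p q u| ≤ Nf p u := by
  have hu' := norm_pos_iff.2 hu
  rcases le_or_gt (1 / 2) ‖u‖ with h | h
  · rw [K1_eq_zero p q u h, abs_zero]; exact Nf_nonneg p u
  · have h1 := kf_sub_le p q ‖u‖ (1 / 2) hp.ne hq.ne' hu' (by norm_num)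
    have h2 := Mf_le_small p q ‖u‖ (by linarith) hu' (by linarith)
    have h3 := Mf_le_small p q (1 / 2) (by linarith) (by norm_num) (by norm_num)
    have h4 := Real.rpow_le_rpow_of_nonpos hu' h.le (show p - 1 ≤ 0 by linarith)
    have h5 : |‖u‖ - 1 / 2| ≤ 1 := by rw [abs_le]; constructor <;> linarith
    unfold K1 Nf
    rw [min_eq_left h.le, if_pos h]
    refine h1.trans ?_
    have h6 : 0 ≤ Mf p q ‖u‖ + Mf p q (1 / 2) := by unfold Mf; positivity
    nlinarith

lemma K2_sub_le (p q : ℝ) (hp : p < 0) (hq : 0 < q) (u v : E) :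
    |K2 p q u - K2 p q v| ≤ ‖u - v‖ *
      ((2 + 2 ^ (1 - p)) * ((2 + ‖u‖) ^ q + (2 + ‖v‖) ^ q)) := by
  unfold K2
  have ha : 1 / 2 ≤ max ‖u‖ (1 / 2) := le_max_right _ _
  have hb : 1 / 2 ≤ max ‖v‖ (1 / 2) := le_max_right _ _
  have ha' : max ‖u‖ (1 / 2) ≤ 1 + ‖u‖ := by
    apply max_le <;> linarith [norm_nonneg u]
  have hb' : max ‖v‖ (1 / 2) ≤ 1 + ‖v‖ := by
    apply max_le <;> linarith [norm_nonneg v]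
  have h1 := kf_sub_le p q _ _ hp.ne hq.ne' (lt_of_lt_of_le (by norm_num) ha)
    (lt_of_lt_of_le (by norm_num) hb)
  have h2 := Mf_le_big p q _ hp hq ha
  have h3 := Mf_le_big p q _ hp hq hb
  have hab : |max ‖u‖ (1 / 2) - max ‖v‖ (1 / 2)| ≤ ‖u - v‖ :=
    (abs_max_sub_max_le_abs _ _ _).trans (abs_norm_sub_norm_le u v)
  have h4 : (1 + max ‖u‖ (1 / 2)) ^ q ≤ (2 + ‖u‖) ^ q :=
    Real.rpow_le_rpow (by linarith) (by linarith) hq.le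
  have h5 : (1 + max ‖v‖ (1 / 2)) ^ q ≤ (2 + ‖v‖) ^ q :=
    Real.rpow_le_rpow (by linarith) (by linarith) hq.le
  have h6 : 0 < 2 + (2:ℝ) ^ (1 - p) := by positivity
  refine h1.trans (mul_le_mul hab ?_ ?_ (norm_nonneg _))
  · nlinarith
  · unfold Mf; positivity

/-! ### gradients -/

lemma hasFDerivAt_norm_rpow_aux (s : ℝ) (hs : s ≠ 0) (u : E) (hu : u ≠ 0) :
    HasFDerivAt (fun v : E => ‖v‖ ^ s / s) (‖u‖ ^ (s - 2) • innerSL ℝ u) u := by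
  have hu' := norm_pos_iff.2 hu
  have h1 : HasFDerivAt (fun v : E => ‖v‖ ^ 2) (2 • innerSL ℝ u) u :=
    (hasStrictFDerivAt_norm_sq u).hasFDerivAt
  have h2 := (h1.rpow_const (p := s / 2) (Or.inl (by positivity))).mul_const s⁻¹
  refine (h2.congr_fderiv ?_).congr_of_eventuallyEq ?_
  · ext v
    have e : (‖u‖ ^ 2) ^ (s / 2 - 1) = ‖u‖ ^ (s - 2) := by
      rw [← Real.rpow_natCast, ← Real.rpow_mul hu'.le]; congr 1; push_cast; ring
    simp [e]
    field_simp
  · refine Eventually.of_forall fun v => ?_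
    have e : (‖v‖ ^ 2) ^ (s / 2) = ‖v‖ ^ s := by
      rw [← Real.rpow_natCast, ← Real.rpow_mul (norm_nonneg v)]; congr 1; push_cast; ring
    show ‖v‖ ^ s / s = (‖v‖ ^ 2) ^ (s / 2) * s⁻¹
    rw [e, div_eq_mul_inv]

lemma hasFDerivAt_Kfun (p q : ℝ) (hp : p ≠ 0) (hq : q ≠ 0) (u : E) (hu : u ≠ 0) :
    HasFDerivAt (Kfun d p q) (innerSL ℝ (gradK d p q u)) u := by
  refine ((hasFDerivAt_norm_rpow_aux q hq u hu).sub
    (hasFDerivAt_norm_rpow_aux p hp u hu)).congr_fderiv ?_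
  simp [gradK]

/-- gradient of the regular part -/
def G2 (p q : ℝ) (u : EuclideanSpace ℝ (Fin d)) : EuclideanSpace ℝ (Fin d) :=
  if 1 / 2 < ‖u‖ then gradK d p q u else 0

lemma hasFDerivAt_K2 (p q : ℝ) (hp : p ≠ 0) (hq : q ≠ 0) (u : E) (hu : ‖u‖ ≠ 1 / 2) :
    HasFDerivAt (K2 p q) (innerSL ℝ (G2 p q u)) u := by
  unfold G2
  split_ifs with h
  · have hu0 : u ≠ 0 := norm_pos_iff.1 (by linarith)
    refine (hasFDerivAt_Kfun p q hp hq u hu0).congr_of_eventuallyEq ?_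
    filter_upwards [continuous_norm.continuousAt.eventually (lt_mem_nhds h)] with v hv
    unfold K2
    rw [max_eq_left (le_of_lt hv)]
    rfl
  · have h' : ‖u‖ < 1 / 2 := lt_of_le_of_ne (not_lt.1 h) hu
    rw [map_zero]
    refine (hasFDerivAt_const (kf p q (1 / 2)) u).congr_of_eventuallyEq ?_
    filter_upwards [continuous_norm.continuousAt.eventually (gt_mem_nhds h')] with v hv
    unfold K2
    rw [max_eq_right (le_of_lt hv)]

lemma norm_gradK_le (p q : ℝ) (u : E) (hu : u ≠ 0) : ‖gradK d p q u‖ ≤ Mf p q ‖u‖ := by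
  have hu' := norm_pos_iff.2 hu
  have h (s : ℝ) : ‖(‖u‖ ^ (s - 2)) • u‖ = ‖u‖ ^ (s - 1) := by
    rw [norm_smul, Real.norm_eq_abs, abs_of_nonneg (by positivity)]
    nth_rw 2 [← Real.rpow_one ‖u‖]
    rw [← Real.rpow_add hu']; congr 1; ring
  unfold gradK Mf
  refine (norm_sub_le _ _).trans ?_
  rw [h, h]

lemma smul_sub_le (s R : ℝ) (hs : s ≤ 0) (hR : 0 < R) (a b : E) (ha : R / 2 ≤ ‖a‖)
    (hb : R / 2 ≤ ‖b‖) (hb' : ‖b‖ ≤ R) :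
    ‖(‖a‖ ^ s) • a - (‖b‖ ^ s) • b‖ ≤ (1 + 4 * |s|) * (R / 2) ^ s * ‖a - b‖ := by
  have ha0 : 0 < ‖a‖ := by linarith
  have hb0 : 0 < ‖b‖ := by linarith
  have e : (‖a‖ ^ s) • a - (‖b‖ ^ s) • b = (‖a‖ ^ s) • (a - b) + (‖a‖ ^ s - ‖b‖ ^ s) • b := by
    module
  rw [e]
  refine (norm_add_le _ _).trans ?_
  rw [norm_smul, norm_smul, Real.norm_eq_abs, Real.norm_eq_abs, abs_of_nonneg (by positivity)]
  have h1 : ‖a‖ ^ s ≤ (R / 2) ^ s := Real.rpow_le_rpow_of_nonpos (by positivity) ha hs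
  have h2 : ‖a‖ ^ (s - 1) ≤ (R / 2) ^ (s - 1) :=
    Real.rpow_le_rpow_of_nonpos (by positivity) ha (by linarith)
  have h3 : ‖b‖ ^ (s - 1) ≤ (R / 2) ^ (s - 1) :=
    Real.rpow_le_rpow_of_nonpos (by positivity) hb (by linarith)
  have h4 := rpow_sub_le s ‖a‖ ‖b‖ ha0 hb0
  have h5 : |‖a‖ - ‖b‖| ≤ ‖a - b‖ := abs_norm_sub_norm_le a b
  have h6 : (R / 2) ^ s = (R / 2) ^ (s - 1) * (R / 2) := by
    rw [Real.rpow_sub_one (by positivity)]; field_simp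
  have h7 : |‖a‖ ^ s - ‖b‖ ^ s| ≤ |s| * ‖a - b‖ * (2 * (R / 2) ^ (s - 1)) := by
    refine h4.trans (mul_le_mul (mul_le_mul_of_nonneg_left h5 (abs_nonneg _)) (by linarith)
      (by positivity) (by positivity))
  have h8 : |‖a‖ ^ s - ‖b‖ ^ s| * ‖b‖ ≤ (|s| * ‖a - b‖ * (2 * (R / 2) ^ (s - 1))) * R :=
    mul_le_mul h7 hb' (norm_nonneg _) (by positivity)
  have h9 := mul_le_mul_of_nonneg_right h1 (norm_nonneg (a - b))
  calc _ ≤ (R / 2) ^ s * ‖a - b‖ + (|s| * ‖a - b‖ * (2 * (R / 2) ^ (s - 1))) * R := add_le_add h9 h8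
    _ = _ := by rw [h6]; ring

/-- main pointwise estimate -/
lemma G2_sub_le (p q : ℝ) (hp : p < 0) (hq : 0 < q) (hq2 : q ≤ 2) :
    ∃ C : ℝ, 0 < C ∧ ∀ x w : E, 2 ≤ ‖x‖ →
      ‖G2 p q (x - w) - gradK d p q x‖ ≤ C * ‖x‖ ^ (q - 2) * (‖w‖ + ‖w‖ ^ 2) := by
  set c0 : ℝ := 2 + 2 ^ (1 - p) with hc0
  have hc0' : 0 < c0 := by positivity
  set A : ℝ := (2 + 4 * |q - 2| + 4 * |p - 2|) * 4 with hA
  have hA0 : 0 < A := by positivity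
  refine ⟨A + 128 * c0, by positivity, fun x w hx => ?_⟩
  set R := ‖x‖ with hR
  have hR0 : 0 < R := by linarith
  have hRq : 0 < R ^ (q - 2) := by positivity
  have hhalf : (R / 2) ^ (q - 2) ≤ 4 * R ^ (q - 2) := by
    rw [Real.div_rpow hR0.le (by norm_num), div_le_iff₀ (by positivity)]
    have : (1:ℝ) ≤ 4 * 2 ^ (q - 2) := by
      have h := Real.rpow_le_rpow_of_exponent_le (show (1:ℝ) ≤ 2 by norm_num)
        (show -2 ≤ q - 2 by linarith)
      have e : (2:ℝ) ^ (-2:ℝ) = 1 / 4 := by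
        rw [Real.rpow_neg (by norm_num)]; norm_num
      rw [e] at h
      linarith
    nlinarith
  rcases le_or_gt ‖w‖ (R / 2) with hw | hw
  · have hxw : R / 2 ≤ ‖x - w‖ := by
      have := norm_sub_norm_le x w
      linarith
    have e : G2 p q (x - w) = gradK d p q (x - w) := by
      unfold G2; rw [if_pos (by linarith)]
    rw [e]
    have h1 := smul_sub_le (q - 2) R (by linarith) hR0 (x - w) x hxw (by linarith) le_rfl
    have h2 := smul_sub_le (p - 2) R (by linarith) hR0 (x - w) x hxw (by linarith) le_rfl
    have h3 : (R / 2) ^ (p - 2) ≤ (R / 2) ^ (q - 2) :=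
      Real.rpow_le_rpow_of_exponent_le (by linarith) (by linarith)
    have ew : ‖x - w - x‖ = ‖w‖ := by rw [sub_sub_cancel_left, norm_neg]
    rw [ew] at h1 h2
    have e2 : gradK d p q (x - w) - gradK d p q x
        = ((‖x - w‖ ^ (q - 2)) • (x - w) - (R ^ (q - 2)) • x)
          - ((‖x - w‖ ^ (p - 2)) • (x - w) - (R ^ (p - 2)) • x) := by
      unfold gradK; abel
    rw [e2]
    refine (norm_sub_le _ _).trans ?_
    have hw0 := norm_nonneg w
    have h4 : (1 + 4 * |p - 2|) * (R / 2) ^ (p - 2) * ‖w‖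
        ≤ (1 + 4 * |p - 2|) * (4 * R ^ (q - 2)) * ‖w‖ := by gcongr; exact h3.trans hhalf
    have h5 : (1 + 4 * |q - 2|) * (R / 2) ^ (q - 2) * ‖w‖
        ≤ (1 + 4 * |q - 2|) * (4 * R ^ (q - 2)) * ‖w‖ := by gcongr
    calc _ ≤ (1 + 4 * |q - 2|) * (4 * R ^ (q - 2)) * ‖w‖
          + (1 + 4 * |p - 2|) * (4 * R ^ (q - 2)) * ‖w‖ := by linarith
      _ = A * R ^ (q - 2) * ‖w‖ := by rw [hA]; ring
      _ ≤ (A + 128 * c0) * R ^ (q - 2) * (‖w‖ + ‖w‖ ^ 2) := by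
        gcongr
        · linarith
        · nlinarith
  · have hw1 : 1 < ‖w‖ := by linarith
    have hw0 : 0 < ‖w‖ := by linarith
    have hb (u : E) (hu : ‖u‖ ≤ 3 * ‖w‖) (hu2 : 1 / 2 ≤ ‖u‖) :
        ‖gradK d p q u‖ ≤ c0 * (16 * ‖w‖ ^ q) := by
      have hu0 : u ≠ 0 := norm_pos_iff.1 (by linarith)
      refine (norm_gradK_le p q u hu0).trans ((Mf_le_big p q _ hp hq hu2).trans ?_)
      refine mul_le_mul_of_nonneg_left ?_ hc0'.le
      calc (1 + ‖u‖) ^ q ≤ (4 * ‖w‖) ^ q :=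
            Real.rpow_le_rpow (by positivity) (by linarith) hq.le
        _ = 4 ^ q * ‖w‖ ^ q := Real.mul_rpow (by norm_num) hw0.le
        _ ≤ 16 * ‖w‖ ^ q := by
          gcongr
          have := Real.rpow_le_rpow_of_exponent_le (show (1:ℝ) ≤ 4 by norm_num) hq2
          refine this.trans (le_of_eq ?_)
          norm_num
    have h1 : ‖gradK d p q x‖ ≤ c0 * (16 * ‖w‖ ^ q) := hb x (by linarith) (by linarith)
    have h2 : ‖G2 p q (x - w)‖ ≤ c0 * (16 * ‖w‖ ^ q) := by
      unfold G2
      split_ifs with h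
      · refine hb _ ?_ h.le
        have := norm_sub_le x w
        linarith
      · rw [norm_zero]; positivity
    have h3 : ‖w‖ ^ q ≤ (4 * R ^ (q - 2)) * ‖w‖ ^ 2 := by
      have e : ‖w‖ ^ q = ‖w‖ ^ (q - 2) * ‖w‖ ^ 2 := by
        rw [← Real.rpow_natCast, ← Real.rpow_add hw0]; congr 1; push_cast; ring
      rw [e]
      refine mul_le_mul_of_nonneg_right ?_ (by positivity)
      exact (Real.rpow_le_rpow_of_nonpos (by positivity) hw.le (by linarith)).trans hhalf
    calc _ ≤ ‖G2 p q (x - w)‖ + ‖gradK d p q x‖ := norm_sub_le _ _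
      _ ≤ 32 * c0 * ‖w‖ ^ q := by linarith
      _ ≤ 32 * c0 * ((4 * R ^ (q - 2)) * ‖w‖ ^ 2) := by gcongr
      _ = 128 * c0 * R ^ (q - 2) * ‖w‖ ^ 2 := by ring
      _ ≤ _ := by
        gcongr
        · linarith
        · linarith

/-! ### Part 2: the mollifying measures -/

/-- measure with density `f` -/
def mm (f : EuclideanSpace ℝ (Fin d) → ℝ) : Measure (EuclideanSpace ℝ (Fin d)) :=
  volume.withDensity fun y => ENNReal.ofReal (f y)

/-- law of the sum of two independent copies -/
def nn (f : EuclideanSpace ℝ (Fin d) → ℝ) : Measure (EuclideanSpace ℝ (Fin d)) :=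
  ((mm f).prod (mm f)).map fun z => z.1 + z.2

lemma mm_prob (f : E → ℝ) (h0 : ∀ y, 0 ≤ f y) (h1 : ∫ y, f y = 1) :
    IsProbabilityMeasure (mm f) := by
  refine ⟨?_⟩
  rw [mm, withDensity_apply _ MeasurableSet.univ, Measure.restrict_univ,
    ← ofReal_integral_eq_lintegral_ofReal (integrable_of_integral_eq_one h1)
      (Eventually.of_forall h0), h1, ENNReal.ofReal_one]

lemma nn_prob (f : E → ℝ) (h0 : ∀ y, 0 ≤ f y) (h1 : ∫ y, f y = 1) :
    IsProbabilityMeasure (nn f) := by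
  have := mm_prob f h0 h1
  exact Measure.isProbabilityMeasure_map (by fun_prop)

lemma mm_lintegral (f : E → ℝ) (hf : Continuous f) (D : E → ℝ≥0∞) (hD : Measurable D) :
    ∫⁻ y, D y ∂(mm f) = ∫⁻ y, ENNReal.ofReal (f y) * D y := by
  rw [mm, lintegral_withDensity_eq_lintegral_mul _ (by fun_prop) hD]
  rfl

lemma mm_le (f : E → ℝ) (hf : Continuous f) (B : ℝ) (D : E → ℝ≥0∞) (hD : Measurable D)
    (hB : ∀ y, D y ≠ 0 → f y ≤ B) :
    ∫⁻ y, D y ∂(mm f) ≤ ENNReal.ofReal B * ∫⁻ y, D y := by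
  rw [mm_lintegral f hf D hD, ← lintegral_const_mul _ hD]
  refine lintegral_mono fun y => ?_
  by_cases h : D y = 0
  · simp [h]
  · exact mul_le_mul' (ENNReal.ofReal_le_ofReal (hB y h)) le_rfl

lemma mm_ac (f : E → ℝ) : mm f ≪ volume := withDensity_absolutelyContinuous _ _

lemma nn_lintegral (f : E → ℝ) (h0 : ∀ y, 0 ≤ f y) (h1 : ∫ y, f y = 1)
    (D : E → ℝ≥0∞) (hD : Measurable D) :
    ∫⁻ w, D w ∂(nn f) = ∫⁻ y, ∫⁻ z, D (y + z) ∂(mm f) ∂(mm f) := by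
  have := mm_prob f h0 h1
  rw [nn, lintegral_map hD (by fun_prop), lintegral_prod _ (by fun_prop)]

lemma nn_le (f : E → ℝ) (hf : Continuous f) (h0 : ∀ y, 0 ≤ f y) (h1 : ∫ y, f y = 1)
    (B : ℝ) (hB : ∀ y, f y ≤ B) (D : E → ℝ≥0∞) (hD : Measurable D) :
    ∫⁻ w, D w ∂(nn f) ≤ ENNReal.ofReal B * ∫⁻ y, D y := by
  have := mm_prob f h0 h1
  rw [nn_lintegral f h0 h1 D hD]
  calc _ ≤ ∫⁻ _y : E, (ENNReal.ofReal B * ∫⁻ y, D y) ∂(mm f) := by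
        refine lintegral_mono fun y => ?_
        refine (mm_le f hf B _ (by fun_prop) fun z _ => hB z).trans ?_
        rw [lintegral_add_left_eq_self D y]
    _ = _ := by simp

lemma nn_tail (f : E → ℝ) (hf : Continuous f) (h0 : ∀ y, 0 ≤ f y) (h1 : ∫ y, f y = 1)
    (A r : ℝ) (hA : ∀ y, r / 2 ≤ ‖y‖ → f y ≤ A) (D : E → ℝ≥0∞) (hD : Measurable D)
    (hr : ∀ w, D w ≠ 0 → r ≤ ‖w‖) :
    ∫⁻ w, D w ∂(nn f) ≤ 2 * ENNReal.ofReal A * ∫⁻ y, D y := by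
  have := mm_prob f h0 h1
  rw [nn_lintegral f h0 h1 D hD]
  set S : Set E := {z | r / 2 ≤ ‖z‖} with hS
  have hSm : MeasurableSet S := measurableSet_le measurable_const measurable_norm
  have hmeas (y : E) : Measurable fun z => S.indicator (fun z => D (y + z)) z :=
    Measurable.indicator (by fun_prop) hSm
  have hin (y : E) : ∫⁻ z, S.indicator (fun z => D (y + z)) z ∂(mm f)
      ≤ ENNReal.ofReal A * ∫⁻ y, D y := by
    refine (mm_le f hf A _ (hmeas y) fun z hz => ?_).trans ?_
    · by_cases hz' : z ∈ S
      · exact hA z hz'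
      · simp [hz'] at hz
    · rw [← lintegral_add_left_eq_self D y]
      gcongr with z
      exact Set.indicator_le_self _ _ _
  have hjoint : Measurable fun t : E × E => S.indicator (fun z => D (t.1 + z)) t.2 := by
    have : (fun t : E × E => S.indicator (fun z => D (t.1 + z)) t.2)
        = (Prod.snd ⁻¹' S).indicator fun t : E × E => D (t.1 + t.2) := by
      ext t; simp only [Set.indicator, Set.mem_preimage]
    rw [this]
    exact Measurable.indicator (by fun_prop) (measurable_snd hSm)
  have hpt (y z : E) : D (y + z) ≤ S.indicator (fun z => D (y + z)) z
      + S.indicator (fun y => D (z + y)) y := by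
    by_cases hd : D (y + z) = 0
    · rw [hd]; exact zero_le
    · have h := (hr _ hd).trans (norm_add_le y z)
      rcases le_or_gt (r / 2) ‖z‖ with hz | hz
      · rw [Set.indicator_of_mem (show z ∈ S from hz)]; exact le_self_add
      · rw [Set.indicator_of_mem (show y ∈ S from by show r / 2 ≤ ‖y‖; linarith) , add_comm z y]
        exact le_add_self
  calc _ ≤ ∫⁻ y, ∫⁻ z, (S.indicator (fun z => D (y + z)) z
          + S.indicator (fun y => D (z + y)) y) ∂(mm f) ∂(mm f) :=
        lintegral_mono fun y => lintegral_mono fun z => hpt y z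
    _ = ∫⁻ y, ∫⁻ z, S.indicator (fun z => D (y + z)) z ∂(mm f) ∂(mm f)
        + ∫⁻ y, ∫⁻ z, S.indicator (fun y => D (z + y)) y ∂(mm f) ∂(mm f) := by
        rw [← lintegral_add_left hjoint.lintegral_prod_right']
        refine lintegral_congr fun y => ?_
        rw [lintegral_add_left (hmeas y)]
    _ = ∫⁻ y, ∫⁻ z, S.indicator (fun z => D (y + z)) z ∂(mm f) ∂(mm f)
        + ∫⁻ y, ∫⁻ z, S.indicator (fun z => D (y + z)) z ∂(mm f) ∂(mm f) := by
        congr 1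
        exact lintegral_lintegral_swap (hjoint.comp measurable_swap).aemeasurable
    _ ≤ ∫⁻ _y : E, (ENNReal.ofReal A * ∫⁻ y, D y) ∂(mm f)
        + ∫⁻ _y : E, (ENNReal.ofReal A * ∫⁻ y, D y) ∂(mm f) :=
        add_le_add (lintegral_mono hin) (lintegral_mono hin)
    _ = _ := by simp only [lintegral_const, measure_univ, mul_one]; ring

lemma nn_ac (f : E → ℝ) (hf : Continuous f) (h0 : ∀ y, 0 ≤ f y) (h1 : ∫ y, f y = 1)
    (B : ℝ) (hB : ∀ y, f y ≤ B) : nn f ≪ volume := by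
  refine Measure.AbsolutelyContinuous.mk fun s hs h => ?_
  have := nn_le f hf h0 h1 B hB (s.indicator 1) (measurable_one.indicator hs)
  rw [lintegral_indicator_one hs, lintegral_indicator_one hs, h, mul_zero] at this
  exact le_antisymm this zero_le

/-! ### Part 3: the singular part -/

lemma measurable_Nf (p : ℝ) : Measurable (Nf p : E → ℝ) := by
  unfold Nf
  refine Measurable.ite (measurableSet_lt measurable_norm measurable_const) ?_ measurable_const
  exact (measurable_norm.pow_const (p - 1)).const_mul 4

lemma measurable_kf (p q : ℝ) : Measurable (kf p q) := by
  unfold kf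
  exact ((measurable_id.pow_const q).div_const q).sub ((measurable_id.pow_const p).div_const p)

lemma measurable_K1 (p q : ℝ) : Measurable (K1 p q : E → ℝ) := by
  unfold K1
  exact ((measurable_kf p q).comp (measurable_norm.min measurable_const)).sub measurable_const

lemma measurable_K2 (p q : ℝ) : Measurable (K2 p q : E → ℝ) := by
  unfold K2
  exact (measurable_kf p q).comp (measurable_norm.max measurable_const)

lemma integrable_Nf (hd : 3 ≤ d) (p : ℝ) (hp : 2 - (d : ℝ) ≤ p) :
    Integrable (Nf p : E → ℝ) := by
  have : Nonempty (Fin d) := ⟨⟨0, by omega⟩⟩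
  have hnt : Nontrivial E := inferInstance
  have h := integrable_fun_norm_addHaar (volume : Measure E) (F := ℝ)
    (f := fun r => if r < 1 / 2 then 4 * r ^ (p - 1) else 0)
  unfold Nf
  rw [h, finrank_euclideanSpace, Fintype.card_fin]
  have h2 : IntegrableOn (fun r : ℝ => 4 * r ^ ((d : ℝ) + p - 2)) (Set.Ioc 0 (1 / 2)) := by
    have := (intervalIntegral.intervalIntegrable_rpow' (a := 0) (b := 1 / 2)
      (show -1 < (d : ℝ) + p - 2 by linarith)).const_mul 4
    rwa [intervalIntegrable_iff_integrableOn_Ioc_of_le (by norm_num)] at this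
  have h3 := (integrable_indicator_iff measurableSet_Ioc).2 h2
  refine Integrable.mono' h3.integrableOn ?_ ?_
  · refine Measurable.aestronglyMeasurable ?_
    refine (measurable_id.pow_const _).smul ?_
    refine Measurable.ite measurableSet_Iio ?_ measurable_const
    exact (measurable_id.pow_const _).const_mul 4
  · refine (ae_restrict_iff' measurableSet_Ioi).2 (Eventually.of_forall fun r hr => ?_)
    have hr0 : 0 < r := hr
    by_cases c : r < 1 / 2
    · rw [Set.indicator_of_mem (show r ∈ Set.Ioc 0 (1 / 2) from ⟨hr0, c.le⟩), if_pos c,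
        smul_eq_mul, Real.norm_eq_abs, abs_of_nonneg (by positivity)]
      refine le_of_eq ?_
      have : r ^ ((d : ℝ) + p - 2) = r ^ (d - 1) * r ^ (p - 1) := by
        rw [← Real.rpow_natCast, ← Real.rpow_add hr0]
        congr 1
        rw [Nat.cast_sub (by omega)]; push_cast; ring
      rw [this]; ring
    · rw [if_neg c]
      simp only [smul_zero, norm_zero]
      refine Set.indicator_nonneg (fun r hr => ?_) r
      have := hr.1
      positivity

/-- transfer of a lintegral bound to an integral bound for `Nf` -/
lemma Nf_transfer (p : ℝ) (hN : Integrable (Nf p : E → ℝ)) (μ : Measure E) (c : ℝ) (hc : 0 ≤ c)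
    (x : E)
    (h : ∫⁻ w, ENNReal.ofReal (Nf p (x - w)) ∂μ
      ≤ ENNReal.ofReal c * ∫⁻ w, ENNReal.ofReal (Nf p (x - w))) :
    Integrable (fun w => Nf p (x - w)) μ ∧ ∫ w, Nf p (x - w) ∂μ ≤ c * ∫ u : E, Nf p u := by
  have e : ∫⁻ w, ENNReal.ofReal (Nf p (x - w)) = ENNReal.ofReal (∫ u : E, Nf p u) := by
    rw [ofReal_integral_eq_lintegral_ofReal hN (Eventually.of_forall (Nf_nonneg p))]
    exact lintegral_sub_left_eq_self (fun u => ENNReal.ofReal (Nf p u)) x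
  have hJ : 0 ≤ ∫ u : E, Nf p u := integral_nonneg (Nf_nonneg p)
  rw [e, ← ENNReal.ofReal_mul hc] at h
  have hm : Measurable fun w : E => Nf p (x - w) := (measurable_Nf p).comp (by fun_prop)
  have hi : Integrable (fun w => Nf p (x - w)) μ := by
    refine ⟨hm.aestronglyMeasurable, ?_⟩
    rw [hasFiniteIntegral_iff_ofReal (Eventually.of_forall fun w => Nf_nonneg p _)]
    exact h.trans_lt ENNReal.ofReal_lt_top
  refine ⟨hi, ?_⟩
  rw [← ofReal_integral_eq_lintegral_ofReal hi (Eventually.of_forall fun w => Nf_nonneg p _)] at h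
  exact (ENNReal.ofReal_le_ofReal_iff (by positivity)).1 h

lemma ae_sub_ne (hd : 3 ≤ d) (μ : Measure E) (hμ : μ ≪ volume) (x : E) :
    ∀ᵐ w ∂μ, x - w ≠ 0 := by
  have : Nonempty (Fin d) := ⟨⟨0, by omega⟩⟩
  have hnt : Nontrivial E := inferInstance
  refine hμ.ae_le ?_
  have : ({x} : Set E)ᶜ ∈ ae (volume : Measure E) := by
    rw [mem_ae_iff, compl_compl]; exact measure_singleton x
  filter_upwards [this] with w hw h
  exact hw (sub_eq_zero.1 h).symm

lemma K1_integrable (hd : 3 ≤ d) (p q : ℝ) (hp : p < 0) (hq : 0 < q) (μ : Measure E)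
    (hμ : μ ≪ volume) (x : E) (hi : Integrable (fun w => Nf p (x - w)) μ) :
    Integrable (fun w => K1 p q (x - w)) μ := by
  refine hi.mono' ((measurable_K1 p q).comp (by fun_prop)).aestronglyMeasurable ?_
  filter_upwards [ae_sub_ne hd μ hμ x] with w hw
  exact K1_abs_le p q hp hq _ hw

lemma K1_lip (hd : 3 ≤ d) (p q : ℝ) (hp : p < 0) (hq : 0 < q) (μ : Measure E)
    (hμ : μ ≪ volume) (x x' : E) (hi : Integrable (fun w => Nf p (x - w)) μ)
    (hi' : Integrable (fun w => Nf p (x' - w)) μ) :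
    ‖∫ w, K1 p q (x' - w) ∂μ - ∫ w, K1 p q (x - w) ∂μ‖
      ≤ ‖x' - x‖ * (∫ w, Nf p (x' - w) ∂μ + ∫ w, Nf p (x - w) ∂μ) := by
  rw [← integral_sub (K1_integrable hd p q hp hq μ hμ x' hi')
    (K1_integrable hd p q hp hq μ hμ x hi), ← integral_add hi' hi, ← integral_const_mul]
  refine norm_integral_le_of_norm_le ((hi'.add hi).const_mul _) ?_
  filter_upwards [ae_sub_ne hd μ hμ x, ae_sub_ne hd μ hμ x'] with w hw hw'
  have := K1_sub_le p q hp hq _ _ hw' hw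
  rwa [sub_sub_sub_cancel_right] at this

lemma mm_integral (f : E → ℝ) (hf : Continuous f) (h0 : ∀ y, 0 ≤ f y) (g : E → ℝ) :
    ∫ y, g y ∂(mm f) = ∫ y, f y * g y := by
  rw [mm, integral_withDensity_eq_integral_toReal_smul (by fun_prop)
    (Eventually.of_forall fun _ => ENNReal.ofReal_lt_top)]
  refine integral_congr_ae (Eventually.of_forall fun y => ?_)
  simp [ENNReal.toReal_ofReal (h0 y)]

/-- single convolution of the singular part -/
def gg (p q : ℝ) (f : EuclideanSpace ℝ (Fin d) → ℝ) (u : EuclideanSpace ℝ (Fin d)) : ℝ :=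
  ∫ z, K1 p q (u - z) ∂(mm f)

lemma gg_differentiable (hd : 3 ≤ d) (p q : ℝ) (hp1 : 2 - (d : ℝ) ≤ p) (hp : p < 0) (hq : 0 < q)
    (f : E → ℝ) (hf : ContDiff ℝ 1 f) (h0 : ∀ y, 0 ≤ f y) (B : ℝ) (hB : ∀ y, f y ≤ B) :
    Differentiable ℝ (gg p q f) := by
  intro u
  have hfc := hf.continuous
  have e : gg p q f = fun u => ∫ t, K1 p q t * f (u - t) := by
    ext u
    unfold gg
    rw [mm_integral f hfc h0, ← integral_sub_left_eq_self _ _ u]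
    simp only [sub_sub_cancel]
    simp_rw [mul_comm]
  have hK : Integrable (K1 p q : E → ℝ) := by
    have := (K1_integrable hd p q hp hq volume Measure.AbsolutelyContinuous.rfl 0
      ((integrable_Nf hd p hp1).comp_sub_left 0)).comp_sub_left 0
    simpa using this
  obtain ⟨L, hL⟩ := (isCompact_closedBall u 2).exists_bound_of_continuousOn
    (hf.continuous_fderiv one_ne_zero).continuousOn
  have hdf : Differentiable ℝ f := hf.differentiable one_ne_zero
  rw [e]
  have key := hasFDerivAt_integral_of_dominated_loc_of_lip' (𝕜 := ℝ) (μ := (volume : Measure E))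
    (F := fun u t => K1 p q t * f (u - t)) (x₀ := u) (s := Metric.ball u 1)
    (bound := fun t => |K1 p q t| * L) (F' := fun t => K1 p q t • fderiv ℝ f (u - t))
    (Metric.ball_mem_nhds u one_pos)
    (fun v _ => ((measurable_K1 p q).mul (hfc.measurable.comp (by fun_prop))).aestronglyMeasurable)
    ?_ ?_ ?_ (hK.abs.mul_const L) ?_
  · exact key.2.differentiableAt
  · refine (hK.abs.mul_const B).mono'
      ((measurable_K1 p q).mul (hfc.measurable.comp (by fun_prop))).aestronglyMeasurable
      (Eventually.of_forall fun t => ?_)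
    rw [norm_mul, Real.norm_eq_abs, Real.norm_eq_abs, abs_of_nonneg (h0 _)]
    exact mul_le_mul_of_nonneg_left (hB _) (abs_nonneg _)
  · exact ((measurable_K1 p q).aestronglyMeasurable).smul
      ((hf.continuous_fderiv one_ne_zero).comp (by fun_prop)).aestronglyMeasurable
  · refine Eventually.of_forall fun t v hv => ?_
    rw [← mul_sub, norm_mul, Real.norm_eq_abs, mul_assoc]
    by_cases ht : 1 / 2 ≤ ‖t‖
    · rw [K1_eq_zero p q t ht]; simp
    · refine mul_le_mul_of_nonneg_left ?_ (abs_nonneg _)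
      have hv' : ‖v - u‖ < 1 := by rwa [← dist_eq_norm]
      have := (convex_closedBall u 2).norm_image_sub_le_of_norm_fderiv_le (𝕜 := ℝ) (f := f)
        (x := u - t) (y := v - t) (C := L) (fun y _ => hdf y) hL
        (by rw [mem_closedBall_iff_norm, sub_sub_cancel_left, norm_neg]; linarith)
        (by
          rw [mem_closedBall_iff_norm, show v - t - u = (v - u) - t by abel]
          linarith [norm_sub_le (v - u) t])
      rwa [sub_sub_sub_cancel_right] at this
  · refine Eventually.of_forall fun t => ?_
    have h1 : HasFDerivAt (fun u => f (u - t)) (fderiv ℝ f (u - t)) u := by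
      have := (hdf (u - t)).hasFDerivAt.comp u ((hasFDerivAt_id u).sub_const t)
      simpa [Function.comp_def] using this
    exact h1.const_mul _

lemma gg_lip (hd : 3 ≤ d) (p q : ℝ) (hp1 : 2 - (d : ℝ) ≤ p) (hp : p < 0) (hq : 0 < q)
    (f : E → ℝ) (hf : Continuous f) (h0 : ∀ y, 0 ≤ f y) (B : ℝ) (hB : ∀ y, f y ≤ B) (u v : E) :
    ‖gg p q f u - gg p q f v‖ ≤ (2 * B * ∫ u : E, Nf p u) * ‖u - v‖ := by
  have hB0 : 0 ≤ B := (h0 0).trans (hB 0)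
  have h (x : E) := Nf_transfer p (integrable_Nf hd p hp1) (mm f) B hB0 x
    (mm_le f hf B _ ((measurable_Nf p).comp (by fun_prop)).ennreal_ofReal fun y _ => hB y)
  have := K1_lip hd p q hp hq (mm f) (mm_ac f) v u (h v).1 (h u).1
  refine this.trans ?_
  have h1 := (h u).2
  have h2 := (h v).2
  rw [mul_comm]
  refine mul_le_mul_of_nonneg_right ?_ (norm_nonneg _)
  linarith

lemma nn_Nf (hd : 3 ≤ d) (p : ℝ) (hp1 : 2 - (d : ℝ) ≤ p)
    (f : E → ℝ) (hf : Continuous f) (h0 : ∀ y, 0 ≤ f y) (h1 : ∫ y, f y = 1)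
    (B : ℝ) (hB : ∀ y, f y ≤ B) (x : E) : Integrable (fun w => Nf p (x - w)) (nn f) :=
  (Nf_transfer p (integrable_Nf hd p hp1) (nn f) B ((h0 0).trans (hB 0)) x
    (nn_le f hf h0 h1 B hB _ ((measurable_Nf p).comp (by fun_prop)).ennreal_ofReal)).1

/-- double convolution of the singular part: differentiable, small derivative far away -/
lemma F1_bound (hd : 3 ≤ d) (p q : ℝ) (hp1 : 2 - (d : ℝ) ≤ p) (hp : p < 0) (hq : 0 < q)
    (f : E → ℝ) (hf : ContDiff ℝ 1 f) (h0 : ∀ y, 0 ≤ f y) (h1 : ∫ y, f y = 1)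
    (B : ℝ) (hB : ∀ y, f y ≤ B) (A : ℝ) (x : E) (hx : 2 ≤ ‖x‖)
    (hA : ∀ y, ‖x‖ / 4 ≤ ‖y‖ → f y ≤ A) :
    DifferentiableAt ℝ (fun x => ∫ w, K1 p q (x - w) ∂(nn f)) x ∧
    ‖fderiv ℝ (fun x => ∫ w, K1 p q (x - w) ∂(nn f)) x‖ ≤ 4 * A * ∫ u : E, Nf p u := by
  have hprob := mm_prob f h0 h1
  have hfc := hf.continuous
  have hac := nn_ac f hfc h0 h1 B hB
  have hN := nn_Nf hd p hp1 f hfc h0 h1 B hB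
  have hA0 : 0 ≤ A := (h0 x).trans (hA x (by linarith))
  have e : (fun x : E => ∫ w, K1 p q (x - w) ∂(nn f)) = fun x => ∫ y, gg p q f (x - y) ∂(mm f) := by
    ext x
    have hi := K1_integrable hd p q hp hq (nn f) hac x (hN x)
    have hadd : Measurable fun z : E × E => z.1 + z.2 := by fun_prop
    unfold nn at hi ⊢
    have hmeas := hi.1
    rw [integrable_map_measure hi.1 hadd.aemeasurable] at hi
    simp only [Function.comp_def] at hi
    rw [integral_map hadd.aemeasurable hmeas]
    rw [integral_prod _ hi]
    simp only [gg, sub_add_eq_sub_sub]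
  have hg := gg_differentiable hd p q hp1 hp hq f hf h0 B hB
  have hgl := gg_lip hd p q hp1 hp hq f hfc h0 B hB
  have hdiff : DifferentiableAt ℝ (fun x => ∫ w, K1 p q (x - w) ∂(nn f)) x := by
    rw [e]
    have key := hasFDerivAt_integral_of_dominated_loc_of_lip' (𝕜 := ℝ) (μ := mm f)
      (F := fun u y => gg p q f (u - y)) (x₀ := x) (s := Set.univ)
      (bound := fun _ => 2 * B * ∫ u : E, Nf p u) (F' := fun y => fderiv ℝ (gg p q f) (x - y))
      univ_mem
      (fun v _ => (hg.continuous.comp (by fun_prop)).aestronglyMeasurable)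
      ?_ ?_ ?_ (integrable_const _) ?_
    · exact key.2.differentiableAt
    · have hi := K1_integrable hd p q hp hq (nn f) hac x (hN x)
      have hadd : Measurable fun z : E × E => z.1 + z.2 := by fun_prop
      unfold nn at hi
      rw [integrable_map_measure hi.1 hadd.aemeasurable] at hi
      refine hi.integral_prod_left.congr (Eventually.of_forall fun y => ?_)
      simp only [gg, sub_add_eq_sub_sub, Function.comp]
    · exact ((measurable_fderiv ℝ (gg p q f)).comp (by fun_prop)).aestronglyMeasurable
    · refine Eventually.of_forall fun y v _ => ?_
      have := hgl (v - y) (x - y)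
      rwa [sub_sub_sub_cancel_right] at this
    · refine Eventually.of_forall fun t => ?_
      have := (hg (x - t)).hasFDerivAt.comp x ((hasFDerivAt_id x).sub_const t)
      simpa [Function.comp_def] using this
  refine ⟨hdiff, ?_⟩
  have hJ : 0 ≤ ∫ u : E, Nf p u := integral_nonneg (Nf_nonneg p)
  refine norm_fderiv_le_of_lip' ℝ (by positivity) ?_
  have hT (v : E) (hv : ‖x‖ - 1 / 2 ≤ ‖v‖) :
      ∫ w, Nf p (v - w) ∂(nn f) ≤ 2 * A * ∫ u : E, Nf p u := by
    refine (Nf_transfer p (integrable_Nf hd p hp1) (nn f) (2 * A) (by positivity) v ?_).2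
    have := nn_tail f hfc h0 h1 A (‖x‖ / 2) (fun y hy => hA y (by linarith))
      (fun w => ENNReal.ofReal (Nf p (v - w)))
      ((measurable_Nf p).comp (by fun_prop)).ennreal_ofReal ?_
    · rwa [ENNReal.ofReal_mul (by norm_num), ENNReal.ofReal_ofNat]
    · intro w hw
      by_contra hlt
      apply hw
      have : ¬ ‖v - w‖ < 1 / 2 := by
        have := norm_sub_norm_le v w
        push Not at hlt ⊢
        linarith
      unfold Nf
      rw [if_neg this, ENNReal.ofReal_zero]
  filter_upwards [Metric.ball_mem_nhds x (show (0:ℝ) < 1 / 2 by norm_num)] with v hv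
  have hv' : ‖v - x‖ < 1 / 2 := by rwa [← dist_eq_norm]
  have hvn : ‖x‖ - 1 / 2 ≤ ‖v‖ := by
    have := norm_sub_norm_le x v
    rw [norm_sub_rev] at this
    linarith
  refine (K1_lip hd p q hp hq (nn f) hac x v (hN x) (hN v)).trans ?_
  rw [mul_comm]
  refine mul_le_mul_of_nonneg_right ?_ (norm_nonneg _)
  linarith [hT v hvn, hT x (by linarith)]

/-! ### Part 4: the regular part -/

lemma K2_abs_le (p q : ℝ) (hq : 0 < q) (hp : p < 0) (u : E) :
    |K2 p q u| ≤ (1 + ‖u‖) ^ q / q + (1 / 2) ^ p / (-p) := by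
  unfold K2 kf
  have ha : 1 / 2 ≤ max ‖u‖ (1 / 2) := le_max_right _ _
  have ha' : max ‖u‖ (1 / 2) ≤ 1 + ‖u‖ := by
    apply max_le <;> linarith [norm_nonneg u]
  have h1 : (max ‖u‖ (1 / 2)) ^ q ≤ (1 + ‖u‖) ^ q := Real.rpow_le_rpow (by linarith) ha' hq.le
  have h2 : (max ‖u‖ (1 / 2)) ^ p ≤ (1 / 2) ^ p := Real.rpow_le_rpow_of_nonpos (by norm_num) ha hp.le
  have hp' : 0 < -p := by linarith
  have e : (max ‖u‖ (1 / 2)) ^ q / q - (max ‖u‖ (1 / 2)) ^ p / p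
      = (max ‖u‖ (1 / 2)) ^ q / q + (max ‖u‖ (1 / 2)) ^ p / (-p) := by
    rw [div_neg]; ring
  rw [e, abs_of_nonneg (by positivity)]
  gcongr

lemma integrable_growth (q : ℝ) (hq2 : q ≤ 2) (μ : Measure E)
    [IsProbabilityMeasure μ] (hm : Integrable (fun w => ‖w‖ ^ 2) μ) (c : ℝ) (hc : 1 ≤ c) :
    Integrable (fun w => (c + ‖w‖) ^ q) μ := by
  refine ((hm.const_mul 2).add (integrable_const (2 * c ^ 2))).mono' ?_
    (Eventually.of_forall fun w => ?_)
  · exact (Measurable.pow_const (by fun_prop) q).aestronglyMeasurable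
  · have hw := norm_nonneg w
    rw [Real.norm_eq_abs, abs_of_nonneg (by positivity)]
    have h1 := Real.rpow_le_rpow_of_exponent_le (show 1 ≤ c + ‖w‖ by linarith) hq2
    rw [Real.rpow_two] at h1
    simp only [Pi.add_apply]
    nlinarith [sq_nonneg (c - ‖w‖)]

lemma K2_integrable (p q : ℝ) (hp : p < 0) (hq : 0 < q) (hq2 : q ≤ 2) (μ : Measure E)
    [IsProbabilityMeasure μ] (hm : Integrable (fun w => ‖w‖ ^ 2) μ) (x : E) :
    Integrable (fun w => K2 p q (x - w)) μ := by
  refine (((integrable_growth q hq2 μ hm (1 + ‖x‖) (by linarith [norm_nonneg x])).div_const q).add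
    (integrable_const ((1 / 2) ^ p / (-p)))).mono'
    ((measurable_K2 p q).comp (by fun_prop)).aestronglyMeasurable
    (Eventually.of_forall fun w => ?_)
  refine (K2_abs_le p q hq hp _).trans ?_
  simp only [Pi.add_apply]
  have h1 : (1 + ‖x - w‖) ^ q ≤ (1 + ‖x‖ + ‖w‖) ^ q :=
    Real.rpow_le_rpow (by positivity) (by linarith [norm_sub_le x w]) hq.le
  have h2 := div_le_div_of_nonneg_right h1 hq.le
  linarith

lemma measurable_G2 (p q : ℝ) : Measurable (G2 p q : E → E) := by
  unfold G2 gradK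
  refine Measurable.ite (measurableSet_lt measurable_const measurable_norm) ?_ measurable_const
  exact ((measurable_norm.pow_const _).smul measurable_id).sub
    ((measurable_norm.pow_const _).smul measurable_id)

lemma F2_deriv (hd : 3 ≤ d) (p q : ℝ) (hp : p < 0) (hq : 0 < q) (hq2 : q ≤ 2) (μ : Measure E)
    [IsProbabilityMeasure μ] (hμ : μ ≪ volume) (hm : Integrable (fun w => ‖w‖ ^ 2) μ) (x : E) :
    Integrable (fun w => innerSL ℝ (G2 p q (x - w))) μ ∧
    HasFDerivAt (fun x => ∫ w, K2 p q (x - w) ∂μ) (∫ w, innerSL ℝ (G2 p q (x - w)) ∂μ) x := by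
  have : Nonempty (Fin d) := ⟨⟨0, by omega⟩⟩
  have hnt : Nontrivial E := inferInstance
  refine hasFDerivAt_integral_of_dominated_loc_of_lip' (𝕜 := ℝ) (μ := μ)
      (F := fun u w => K2 p q (u - w)) (x₀ := x) (s := Metric.ball x 1)
      (bound := fun w => (2 + 2 ^ (1 - p)) * (2 * ((3 + ‖x‖) + ‖w‖) ^ q))
      (F' := fun w => innerSL ℝ (G2 p q (x - w)))
      (Metric.ball_mem_nhds x one_pos)
      (fun v _ => ((measurable_K2 p q).comp (by fun_prop)).aestronglyMeasurable)
      (K2_integrable p q hp hq hq2 μ hm x) ?_ ?_ ?_ ?_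
  · exact (((innerSL ℝ).continuous.measurable).comp
      ((measurable_G2 p q).comp (by fun_prop))).aestronglyMeasurable
  · refine Eventually.of_forall fun w v hv => ?_
    have hv' : ‖v - x‖ < 1 := by rwa [← dist_eq_norm]
    have h := K2_sub_le p q hp hq (v - w) (x - w)
    rw [sub_sub_sub_cancel_right] at h
    refine h.trans ?_
    rw [mul_comm]
    refine mul_le_mul_of_nonneg_right (mul_le_mul_of_nonneg_left ?_ (by positivity)) (norm_nonneg _)
    have h1 : ‖x - w‖ ≤ ‖x‖ + ‖w‖ := norm_sub_le x w
    have h2 : ‖v - w‖ ≤ 1 + ‖x‖ + ‖w‖ := by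
      have := norm_add_le (v - x) (x - w)
      rw [sub_add_sub_cancel] at this
      linarith
    have h3 : (2 + ‖v - w‖) ^ q ≤ (3 + ‖x‖ + ‖w‖) ^ q :=
      Real.rpow_le_rpow (by positivity) (by linarith) hq.le
    have h4 : (2 + ‖x - w‖) ^ q ≤ (3 + ‖x‖ + ‖w‖) ^ q :=
      Real.rpow_le_rpow (by positivity) (by linarith) hq.le
    linarith
  · exact ((integrable_growth q hq2 μ hm (3 + ‖x‖) (by linarith [norm_nonneg x])).const_mul
      2).const_mul _
  · have hs : (Metric.sphere x (1 / 2))ᶜ ∈ ae μ := by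
      rw [mem_ae_iff, compl_compl]
      exact hμ (Measure.addHaar_sphere volume x (1 / 2))
    filter_upwards [hs] with w hw
    have hw' : ‖x - w‖ ≠ 1 / 2 := by
      intro h
      apply hw
      rw [mem_sphere_iff_norm, norm_sub_rev]; exact h
    have h1 := hasFDerivAt_K2 p q hp.ne hq.ne' (x - w) hw'
    have := h1.comp x ((hasFDerivAt_id x).sub_const w)
    simpa [Function.comp_def] using this

lemma F2_close (hd : 3 ≤ d) (p q : ℝ) (hp : p < 0) (hq : 0 < q) (hq2 : q ≤ 2) (μ : Measure E)
    [IsProbabilityMeasure μ] (hμ : μ ≪ volume) (hm : Integrable (fun w => ‖w‖ ^ 2) μ)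
    (hk : Integrable (fun w => ‖w‖ + ‖w‖ ^ 2) μ) (C : ℝ) (x : E)
    (hC : ∀ w : E, ‖G2 p q (x - w) - gradK d p q x‖ ≤ C * ‖x‖ ^ (q - 2) * (‖w‖ + ‖w‖ ^ 2)) :
    ‖(∫ w, innerSL ℝ (G2 p q (x - w)) ∂μ) - innerSL ℝ (gradK d p q x)‖
      ≤ C * ‖x‖ ^ (q - 2) * ∫ w, (‖w‖ + ‖w‖ ^ 2) ∂μ := by
  have hi := (F2_deriv hd p q hp hq hq2 μ hμ hm x).1
  have e : (∫ w, innerSL ℝ (G2 p q (x - w)) ∂μ) - innerSL ℝ (gradK d p q x)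
      = ∫ w, (innerSL ℝ (G2 p q (x - w)) - innerSL ℝ (gradK d p q x)) ∂μ := by
    rw [integral_sub hi (integrable_const _)]; simp
  rw [e, ← integral_const_mul]
  refine norm_integral_le_of_norm_le (hk.const_mul _) (Eventually.of_forall fun w => ?_)
  rw [← map_sub, innerSL_apply_norm]
  exact hC w

/-- moments of the sum -/
lemma nn_moment (f : E → ℝ) (h0 : ∀ y, 0 ≤ f y) (h1 : ∫ y, f y = 1)
    (hk : Integrable (fun w => ‖w‖ + ‖w‖ ^ 2) (mm f)) :
    Integrable (fun w => ‖w‖ + ‖w‖ ^ 2) (nn f) ∧ Integrable (fun w => ‖w‖ ^ 2) (nn f) ∧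
    ∫ w, (‖w‖ + ‖w‖ ^ 2) ∂(nn f) ≤ 4 * ∫ w, (‖w‖ + ‖w‖ ^ 2) ∂(mm f) := by
  have hprob := mm_prob f h0 h1
  have hadd : Measurable fun z : E × E => z.1 + z.2 := by fun_prop
  have hc : Continuous fun w : E => ‖w‖ + ‖w‖ ^ 2 := by fun_prop
  have hpt (y z : E) : ‖y + z‖ + ‖y + z‖ ^ 2
      ≤ 2 * (‖y‖ + ‖y‖ ^ 2) + 2 * (‖z‖ + ‖z‖ ^ 2) := by
    have h := norm_add_le y z
    have h' := norm_nonneg (y + z)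
    have hy := norm_nonneg y
    have hz := norm_nonneg z
    nlinarith [sq_nonneg (‖y‖ - ‖z‖)]
  have hdom : Integrable (fun z : E × E => 2 * (‖z.1‖ + ‖z.1‖ ^ 2) + 2 * (‖z.2‖ + ‖z.2‖ ^ 2))
      ((mm f).prod (mm f)) :=
    ((hk.const_mul 2).comp_fst (mm f)).add ((hk.const_mul 2).comp_snd (mm f))
  have hi' : Integrable (fun z : E × E => ‖z.1 + z.2‖ + ‖z.1 + z.2‖ ^ 2)
      ((mm f).prod (mm f)) := by
    refine hdom.mono' (by fun_prop) (Eventually.of_forall fun z => ?_)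
    rw [Real.norm_eq_abs, abs_of_nonneg (by positivity)]
    exact hpt _ _
  have hi : Integrable (fun w => ‖w‖ + ‖w‖ ^ 2) (nn f) := by
    unfold nn
    rw [integrable_map_measure hc.aestronglyMeasurable hadd.aemeasurable]
    exact hi'
  refine ⟨hi, hi.mono' (by fun_prop) (Eventually.of_forall fun w => ?_), ?_⟩
  · rw [Real.norm_eq_abs, abs_of_nonneg (by positivity)]
    linarith [norm_nonneg w]
  · unfold nn
    rw [integral_map hadd.aemeasurable hc.aestronglyMeasurable]
    refine (integral_mono hi' hdom fun z => hpt _ _).trans (le_of_eq ?_)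
    rw [integral_add ((hk.const_mul 2).comp_fst (mm f)) ((hk.const_mul 2).comp_snd (mm f)),
      integral_fun_fst (fun w : E => 2 * (‖w‖ + ‖w‖ ^ 2)),
      integral_fun_snd (fun w : E => 2 * (‖w‖ + ‖w‖ ^ 2)), integral_const_mul]
    simp
    ring

/-! ### Part 5: the scaled mollifier -/

lemma scaled_integral (φ : E → ℝ) (ε : ℝ) (hε : 0 < ε) (h : ∫ y, φ y = 1) :
    ∫ y, scaled d φ ε y = 1 := by
  unfold scaled
  rw [integral_const_mul, Measure.integral_comp_inv_smul_of_nonneg _ _ hε.le, h,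
    finrank_euclideanSpace, Fintype.card_fin]
  simp [hε.ne']

lemma scaled_moment (φ : E → ℝ) (hφ : Continuous φ) (h0 : ∀ y, 0 ≤ φ y) (ε : ℝ) (hε : 0 < ε)
    (hε1 : ε < 1)
    (hi1 : Integrable fun y => φ y * ‖y‖) (hi2 : Integrable fun y => φ y * ‖y‖ ^ 2) :
    Integrable (fun w => ‖w‖ + ‖w‖ ^ 2) (mm (scaled d φ ε)) ∧
    ∫ w, (‖w‖ + ‖w‖ ^ 2) ∂(mm (scaled d φ ε))
      ≤ ε * ((∫ y, φ y * ‖y‖) + ∫ y, φ y * ‖y‖ ^ 2) := by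
  have hs0 (y : E) : 0 ≤ scaled d φ ε y := by
    unfold scaled; exact mul_nonneg (by positivity) (h0 _)
  have hsc : Continuous (scaled d φ ε) := by unfold scaled; fun_prop
  set h : E → ℝ := fun u => ε * (φ u * ‖u‖) + ε ^ 2 * (φ u * ‖u‖ ^ 2) with hh
  have hhi : Integrable h := (hi1.const_mul ε).add (hi2.const_mul (ε ^ 2))
  have e (y : E) : scaled d φ ε y * (‖y‖ + ‖y‖ ^ 2) = (ε ^ d)⁻¹ * h (ε⁻¹ • y) := by
    simp only [scaled, hh, norm_smul, norm_inv, Real.norm_eq_abs, abs_of_pos hε]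
    field_simp
  constructor
  · unfold mm
    rw [integrable_withDensity_iff (by fun_prop)
      (Eventually.of_forall fun _ => ENNReal.ofReal_lt_top)]
    refine ((hhi.comp_smul (inv_ne_zero hε.ne')).const_mul (ε ^ d)⁻¹).congr
      (Eventually.of_forall fun y => ?_)
    simp only [ENNReal.toReal_ofReal (hs0 y)]
    rw [← e]; ring
  · rw [mm_integral _ hsc hs0]
    simp_rw [e]
    rw [integral_const_mul, Measure.integral_comp_inv_smul_of_nonneg _ _ hε.le,
      finrank_euclideanSpace, Fintype.card_fin, smul_eq_mul,
      inv_mul_cancel_left₀ (by positivity), hh, integral_add (hi1.const_mul ε)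
      (hi2.const_mul (ε ^ 2)), integral_const_mul, integral_const_mul]
    have h2 : 0 ≤ ∫ y, φ y * ‖y‖ ^ 2 := integral_nonneg fun y => mul_nonneg (h0 y) (by positivity)
    have h3 : ε ^ 2 ≤ ε := by nlinarith
    nlinarith

lemma Kreg_eq (hd : 3 ≤ d) (p q : ℝ) (hp : p < 0) (hq : 0 < q) (hq2 : q ≤ 2) (φ : E → ℝ) (ε : ℝ)
    (f : E → ℝ) (hfe : f = scaled d φ ε) (hf : Continuous f)
    (h0 : ∀ y, 0 ≤ f y) (h1 : ∫ y, f y = 1) (hac : nn f ≪ volume)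
    (hN : ∀ x, Integrable (fun w => Nf p (x - w)) (nn f))
    (hm : Integrable (fun w => ‖w‖ ^ 2) (nn f)) :
    Kreg d p q φ ε = (fun x => ∫ w, K1 p q (x - w) ∂(nn f)) + fun x => ∫ w, K2 p q (x - w) ∂(nn f) := by
  ext x
  have hprob := mm_prob f h0 h1
  have hprob' := nn_prob f h0 h1
  have hi1 := K1_integrable hd p q hp hq (nn f) hac x (hN x)
  have hi2 := K2_integrable p q hp hq hq2 (nn f) hm x
  have hi : Integrable (fun w => K1 p q (x - w) + K2 p q (x - w)) (nn f) := hi1.add hi2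
  simp only [Pi.add_apply]
  rw [← integral_add hi1 hi2]
  have hadd : Measurable fun z : E × E => z.1 + z.2 := by fun_prop
  unfold nn at hi ⊢
  have hmeas := hi.1
  rw [integrable_map_measure hi.1 hadd.aemeasurable] at hi
  simp only [Function.comp_def] at hi
  rw [integral_map hadd.aemeasurable hmeas, integral_prod _ hi, mm_integral f hf h0]
  unfold Kreg
  rw [← hfe]
  refine integral_congr_ae (Eventually.of_forall fun y => ?_)
  simp only
  rw [mm_integral f hf h0, ← integral_const_mul]
  refine integral_congr_ae (Eventually.of_forall fun z => ?_)
  simp only [Kfun_eq, sub_add_eq_sub_sub]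
  ring

/-- boundedness and moments of the mollifier -/
lemma mollifier_facts (hd : 3 ≤ d) (φ : E → ℝ) (hφ : Continuous φ) (h0 : ∀ y, 0 ≤ φ y)
    (C : ℝ) (hC : 0 < C) (l : ℝ) (hl : max (2 * (d : ℝ) + 1) 4 ≤ l)
    (hdec : ∀ x : E, x ≠ 0 → φ x ≤ C * ‖x‖ ^ (-l)) :
    (∃ B : ℝ, ∀ y, φ y ≤ B) ∧ Integrable (fun y => φ y * ‖y‖) ∧
      Integrable (fun y => φ y * ‖y‖ ^ 2) := by
  have hl1 : 2 * (d : ℝ) + 1 ≤ l := (le_max_left _ _).trans hl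
  have hl4 : 4 ≤ l := (le_max_right _ _).trans hl
  have hd' : (3:ℝ) ≤ d := by exact_mod_cast hd
  obtain ⟨B, hB⟩ := (isCompact_closedBall (0 : E) 1).exists_bound_of_continuousOn hφ.continuousOn
  have hB0 : 0 ≤ B := (norm_nonneg _).trans (hB 0 (by simp))
  have key (y : E) : φ y ≤ (B + C) * 2 ^ l * (1 + ‖y‖) ^ (-l) := by
    have hy := norm_nonneg y
    have hpos : 0 < 1 + ‖y‖ := by linarith
    have e : (2:ℝ) ^ l * (1 + ‖y‖) ^ (-l) = ((1 + ‖y‖) / 2) ^ (-l) := by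
      rw [Real.div_rpow hpos.le (by norm_num), Real.rpow_neg (by norm_num : (0:ℝ) ≤ 2)]
      field_simp
    rw [mul_assoc, e]
    have hp0 : 0 < ((1 + ‖y‖) / 2) ^ (-l) := by positivity
    rcases le_or_gt ‖y‖ 1 with h | h
    · have h2 := hB y (by simpa using h)
      have h3 : 1 ≤ ((1 + ‖y‖) / 2) ^ (-l) :=
        Real.one_le_rpow_of_pos_of_le_one_of_nonpos (by positivity) (by linarith) (by linarith)
      have h4 : φ y ≤ B := (Real.le_norm_self _).trans h2
      nlinarith
    · have hne : y ≠ 0 := norm_pos_iff.1 (by linarith)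
      have h2 := hdec y hne
      have h3 : ‖y‖ ^ (-l) ≤ ((1 + ‖y‖) / 2) ^ (-l) :=
        Real.rpow_le_rpow_of_nonpos (by positivity) (by linarith) (by linarith)
      nlinarith
  have hpow (r : ℝ) (hr : (d : ℝ) < r) : Integrable fun y : E => (1 + ‖y‖) ^ (-r) :=
    integrable_one_add_norm (by rwa [finrank_euclideanSpace, Fintype.card_fin])
  have h2 (n : ℕ) (hn : n ≤ 2) (hn1 : 1 ≤ n) : Integrable fun y => φ y * ‖y‖ ^ n := by
    refine ((hpow (l - 2) (by linarith)).const_mul ((B + C) * 2 ^ l)).mono' (by fun_prop)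
      (Eventually.of_forall fun y => ?_)
    have hy := norm_nonneg y
    have hpos : 0 < 1 + ‖y‖ := by linarith
    rw [Real.norm_eq_abs, abs_of_nonneg (mul_nonneg (h0 y) (by positivity))]
    have h3 : ‖y‖ ^ n ≤ (1 + ‖y‖) ^ 2 :=
      (pow_le_pow_left₀ hy (by linarith) n).trans (pow_le_pow_right₀ (by linarith) hn)
    have e : (1 + ‖y‖) ^ (-(l - 2)) = (1 + ‖y‖) ^ (-l) * (1 + ‖y‖) ^ 2 := by
      rw [← Real.rpow_natCast, ← Real.rpow_add hpos]; congr 1; push_cast; ring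
    rw [e, ← mul_assoc]
    exact mul_le_mul (key y) h3 (by positivity) (by positivity)
  refine ⟨⟨(B + C) * 2 ^ l, fun y => (key y).trans ?_⟩, by simpa using h2 1 (by norm_num) le_rfl,
    h2 2 le_rfl (by norm_num)⟩
  have : (1 + ‖y‖) ^ (-l) ≤ 1 :=
    Real.rpow_le_one_of_one_le_of_nonpos (by linarith [norm_nonneg y]) (by linarith)
  exact mul_le_of_le_one_right (by positivity) this

lemma scaled_tail (φ : E → ℝ) (q : ℝ) (hq : 0 < q)
    (C : ℝ) (hC : 0 < C) (l : ℝ) (hl : max (2 * (d : ℝ) + 1) 4 ≤ l)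
    (hdec : ∀ x : E, x ≠ 0 → φ x ≤ C * ‖x‖ ^ (-l)) (ε : ℝ) (hε : 0 < ε) (hε1 : ε < 1)
    (R : ℝ) (hR : 2 ≤ R) (y : E) (hy : R / 4 ≤ ‖y‖) :
    scaled d φ ε y ≤ C * 4 ^ l * ε * R ^ (q - 2) := by
  have hl1 : 2 * (d : ℝ) + 1 ≤ l := (le_max_left _ _).trans hl
  have hl4 : 4 ≤ l := (le_max_right _ _).trans hl
  have hR0 : 0 < R := by linarith
  have hd0 : (0:ℝ) ≤ d := Nat.cast_nonneg d
  have hy0 : 0 < ‖y‖ := by linarith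
  have hne : ε⁻¹ • y ≠ 0 := smul_ne_zero (inv_ne_zero hε.ne') (norm_pos_iff.1 hy0)
  have h1 := hdec _ hne
  rw [norm_smul, norm_inv, Real.norm_eq_abs, abs_of_pos hε,
    Real.mul_rpow (by positivity) hy0.le] at h1
  have e1 : (ε⁻¹) ^ (-l) = ε ^ l := by
    rw [Real.inv_rpow hε.le, ← Real.rpow_neg hε.le, neg_neg]
  rw [e1] at h1
  have e2 : (ε ^ d)⁻¹ * ε ^ l ≤ ε := by
    have : (ε ^ d)⁻¹ * ε ^ l = ε ^ (l - d) := by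
      rw [Real.rpow_sub hε, Real.rpow_natCast]; field_simp
    rw [this]
    have := Real.rpow_le_rpow_of_exponent_ge hε hε1.le (show 1 ≤ l - d by linarith)
    rwa [Real.rpow_one] at this
  have e3 : ‖y‖ ^ (-l) ≤ 4 ^ l * R ^ (q - 2) := by
    refine (Real.rpow_le_rpow_of_nonpos (by positivity) hy (by linarith)).trans ?_
    rw [Real.div_rpow hR0.le (by norm_num), Real.rpow_neg (by norm_num : (0:ℝ) ≤ 4), div_inv_eq_mul,
      mul_comm]
    gcongr
    · linarith
    · linarith
  unfold scaled
  calc (ε ^ d)⁻¹ * φ (ε⁻¹ • y) ≤ (ε ^ d)⁻¹ * (C * (ε ^ l * ‖y‖ ^ (-l))) := by gcongr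
    _ = C * ((ε ^ d)⁻¹ * ε ^ l) * ‖y‖ ^ (-l) := by ring
    _ ≤ C * ε * (4 ^ l * R ^ (q - 2)) := by gcongr
    _ = _ := by ring

end KernelProof

/-- `|∂_{x_i} K_ε(x) - ∂_{x_i} K(x)| ≤ C ε |x|^{q-2}` for `x_i > 2` and
`0 < ε < 1`, where `∂_{x_i}K(x) = x_i|x|^{q-2} - x_i|x|^{p-2}`. -/
theorem deriv_regularized_kernel_close
    (d : ℕ) (hd : 3 ≤ d) (p q : ℝ) (hp1 : 2 - (d : ℝ) ≤ p) (hp2 : p < 0)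
    (hq1 : 0 < q) (hq2 : q ≤ 2)
    (φ : EuclideanSpace ℝ (Fin d) → ℝ) (hφ : IsMollifier d φ) :
    ∃ C : ℝ, 0 < C ∧ ∀ ε : ℝ, 0 < ε → ε < 1 → ∀ i : Fin d,
      ∀ x : EuclideanSpace ℝ (Fin d), 2 < x i →
        |fderiv ℝ (Kreg d p q φ ε) x (EuclideanSpace.single i 1) -
            (x i * ‖x‖ ^ (q - 2) - x i * ‖x‖ ^ (p - 2))|
          ≤ C * ε * ‖x‖ ^ (q - 2) := by

  obtain ⟨hsm, -, h0, h1, Cφ, hCφ, l, hl, hdec⟩ := hφ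
  have hφc : Continuous φ := hsm.continuous
  obtain ⟨⟨B, hB⟩, hi1, hi2⟩ := mollifier_facts hd φ hφc h0 Cφ hCφ l hl hdec
  obtain ⟨Cg, hCg, hG⟩ := G2_sub_le (d := d) p q hp2 hq1 hq2
  set J : ℝ := ∫ u : EuclideanSpace ℝ (Fin d), Nf p u with hJ
  have hJ0 : 0 ≤ J := integral_nonneg (Nf_nonneg p)
  set M : ℝ := (∫ y, φ y * ‖y‖) + ∫ y, φ y * ‖y‖ ^ 2 with hM
  have hM0 : 0 ≤ M := add_nonneg (integral_nonneg fun y => mul_nonneg (h0 y) (by positivity))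
    (integral_nonneg fun y => mul_nonneg (h0 y) (by positivity))
  refine ⟨4 * (Cφ * 4 ^ l) * J + Cg * (4 * M) + 1, by positivity, fun ε hε hε1 i x hxi => ?_⟩
  have hx : 2 ≤ ‖x‖ := by
    have h2 := PiLp.norm_apply_le x i
    rw [Real.norm_eq_abs] at h2
    linarith [le_abs_self (x i)]
  have hx0 : 0 < ‖x‖ := by linarith
  set f := scaled d φ ε with hf
  have hfs : ContDiff ℝ 1 f := by
    have : ContDiff ℝ 1 φ := hsm.of_le (by exact_mod_cast le_top)
    rw [hf]
    unfold scaled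
    fun_prop
  have hfc := hfs.continuous
  have hf0 (y) : 0 ≤ f y := mul_nonneg (by positivity) (h0 _)
  have hf1 : ∫ y, f y = 1 := scaled_integral φ ε hε h1
  have hfB (y) : f y ≤ (ε ^ d)⁻¹ * B := mul_le_mul_of_nonneg_left (hB _) (by positivity)
  obtain ⟨hk, hkM⟩ := scaled_moment φ hφc h0 ε hε hε1 hi1 hi2
  obtain ⟨hk', hm, hkM'⟩ := nn_moment f hf0 hf1 hk
  have hac := nn_ac f hfc hf0 hf1 _ hfB
  have hprob := nn_prob f hf0 hf1
  have hN := nn_Nf hd p hp1 f hfc hf0 hf1 _ hfB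
  obtain ⟨hD1, hb1⟩ := F1_bound hd p q hp1 hp2 hq1 f hfs hf0 hf1 _ hfB
    (Cφ * 4 ^ l * ε * ‖x‖ ^ (q - 2)) x hx
    (fun y hy => scaled_tail φ q hq1 Cφ hCφ l hl hdec ε hε hε1 ‖x‖ hx y hy)
  have hD2 := (F2_deriv hd p q hp2 hq1 hq2 (nn f) hac hm x).2
  have hb2 := F2_close hd p q hp2 hq1 hq2 (nn f) hac hm hk' Cg x (fun w => hG x w hx)
  have hR : 0 < ‖x‖ ^ (q - 2) := by positivity
  rw [Kreg_eq hd p q hp2 hq1 hq2 φ ε f hf hfc hf0 hf1 hac hN hm, fderiv_add hD1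
    hD2.differentiableAt, hD2.fderiv]
  set L1 := fderiv ℝ (fun x => ∫ w, K1 p q (x - w) ∂(nn f)) x
  set L2 := ∫ w, innerSL ℝ (G2 p q (x - w)) ∂(nn f)
  have hgrad : x i * ‖x‖ ^ (q - 2) - x i * ‖x‖ ^ (p - 2)
      = innerSL ℝ (gradK d p q x) (EuclideanSpace.single i 1) := by
    simp [gradK, EuclideanSpace.inner_single_right]
    ring
  have e : (L1 + L2) (EuclideanSpace.single i 1)
        - (x i * ‖x‖ ^ (q - 2) - x i * ‖x‖ ^ (p - 2))
      = (L1 + (L2 - innerSL ℝ (gradK d p q x))) (EuclideanSpace.single i 1) := by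
    rw [hgrad]
    simp only [ContinuousLinearMap.add_apply, ContinuousLinearMap.sub_apply]
    ring
  rw [e, ← Real.norm_eq_abs]
  have hle := (L1 + (L2 - innerSL ℝ (gradK d p q x))).le_opNorm (EuclideanSpace.single i 1)
  have hn1 : ‖(EuclideanSpace.single i 1 : EuclideanSpace ℝ (Fin d))‖ = 1 := by simp
  rw [hn1, mul_one] at hle
  have hb3 : Cg * ‖x‖ ^ (q - 2) * ∫ w, (‖w‖ + ‖w‖ ^ 2) ∂(nn f)
      ≤ Cg * ‖x‖ ^ (q - 2) * (4 * (ε * M)) := by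
    refine mul_le_mul_of_nonneg_left ?_ (by positivity)
    linarith
  have hpos : 0 ≤ ε * ‖x‖ ^ (q - 2) := by positivity
  calc _ ≤ ‖L1‖ + ‖L2 - innerSL ℝ (gradK d p q x)‖ := hle.trans (norm_add_le _ _)
    _ ≤ 4 * (Cφ * 4 ^ l * ε * ‖x‖ ^ (q - 2)) * J + Cg * ‖x‖ ^ (q - 2) * (4 * (ε * M)) :=
        add_le_add hb1 (hb2.trans hb3)
    _ = (4 * (Cφ * 4 ^ l) * J + Cg * (4 * M)) * (ε * ‖x‖ ^ (q - 2)) := by ring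
    _ ≤ (4 * (Cφ * 4 ^ l) * J + Cg * (4 * M) + 1) * (ε * ‖x‖ ^ (q - 2)) := by
        refine mul_le_mul_of_nonneg_right ?_ hpos
        linarith
    _ = _ := by ring
end
end

section
/- The regularized kernels are coercive and eventually coordinate-increasing: (a) for every ε > 0 and every x ∈ ℝ^d, K_ε(x) ≥ inf{ K(z) : |z| ≥ |x|/2 }, and consequently K_ε(x) → +∞ as |x| → +∞; (b) there exists ε₀ > 0 such that for all 0 < ε < ε₀, every coordinate index i, and every x with x_i > 2, ∂_{x_i} K_ε(x) ≥ 0, so K_ε is nondecreasing in each coordinate on {x_i > 2}. -/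
open MeasureTheory Filter
open scoped ENNReal Topology NNReal

noncomputable section

local notation "EE" d => EuclideanSpace ℝ (Fin d)



lemma aux_Kfun_nonneg (d : ℕ) {p q : ℝ} (hp2 : p < 0) (hq1 : 0 < q) (z : EE d) :
    0 ≤ Kfun d p q z := by
  unfold Kfun
  have h1 : 0 ≤ ‖z‖ ^ q / q := by positivity
  have h2 : ‖z‖ ^ p / p ≤ 0 := div_nonpos_of_nonneg_of_nonpos (by positivity) hp2.le
  linarith

lemma aux_rpow_tangent {r s a : ℝ} (hr : 0 < r) (hs : 0 < s) :
    s ^ a * (1 + a * (Real.log r - Real.log s)) ≤ r ^ a := by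
  have h := Real.add_one_le_exp (a * (Real.log r - Real.log s))
  have h2 : r ^ a = s ^ a * Real.exp (a * (Real.log r - Real.log s)) := by
    rw [Real.rpow_def_of_pos hr, Real.rpow_def_of_pos hs, ← Real.exp_add]
    congr 1; ring
  rw [h2]
  have := Real.rpow_pos_of_pos hs a
  nlinarith

lemma aux_tangent (d : ℕ) {p q : ℝ} (hp2 : p < 0) (hq1 : 0 < q) {x z : EE d}
    (hx : x ≠ 0) (hz : z ≠ 0) :
    Kfun d p q x + (‖x‖ ^ q - ‖x‖ ^ p) * (Real.log ‖z‖ - Real.log ‖x‖) ≤ Kfun d p q z := by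
  have hx' : 0 < ‖x‖ := norm_pos_iff.mpr hx
  have hz' : 0 < ‖z‖ := norm_pos_iff.mpr hz
  have h1 := aux_rpow_tangent (a := q) hz' hx'
  have h2 := aux_rpow_tangent (a := p) hz' hx'
  have h3 := (div_le_div_iff_of_pos_right hq1).mpr h1
  have h4 := (div_le_div_right_of_neg hp2).mpr h2
  unfold Kfun
  have e1 : ‖x‖ ^ q * (1 + q * (Real.log ‖z‖ - Real.log ‖x‖)) / q
    = ‖x‖ ^ q / q + ‖x‖ ^ q * (Real.log ‖z‖ - Real.log ‖x‖) := by field_simp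
  have e2 : ‖x‖ ^ p * (1 + p * (Real.log ‖z‖ - Real.log ‖x‖)) / p
    = ‖x‖ ^ p / p + ‖x‖ ^ p * (Real.log ‖z‖ - Real.log ‖x‖) := by
    have := hp2.ne
    field_simp
  rw [e1] at h3
  rw [e2] at h4
  linarith

lemma aux_abs_log_le (d : ℕ) {p q : ℝ} (hp2 : p < 0) (hq1 : 0 < q) (z : EE d) :
    |Real.log ‖z‖| ≤ Kfun d p q z := by
  rcases eq_or_ne z 0 with rfl | hz
  · simpa using aux_Kfun_nonneg d hp2 hq1 (0 : EE d)
  have hz' : 0 < ‖z‖ := norm_pos_iff.mpr hz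
  have h1 := Real.log_le_rpow_div hz'.le hq1
  have h2 := Real.log_le_rpow_div (x := ‖z‖⁻¹) (by positivity) (neg_pos.mpr hp2)
  rw [Real.log_inv, Real.inv_rpow hz'.le, Real.rpow_neg hz'.le, inv_inv, div_neg] at h2
  have h3 : 0 ≤ ‖z‖ ^ q / q := by positivity
  have h4 : ‖z‖ ^ p / p ≤ 0 := div_nonpos_of_nonneg_of_nonpos (by positivity) hp2.le
  unfold Kfun
  rw [abs_le]; constructor <;> linarith

/-- singular part -/
def Nsing (d : ℕ) (p : ℝ) (z : EE d) : ℝ := if ‖z‖ < 1 then ‖z‖ ^ (p - 1) else 0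

lemma Nsing_nonneg (d : ℕ) (p : ℝ) (z : EE d) : 0 ≤ Nsing d p z := by
  unfold Nsing; split_ifs <;> positivity

lemma Nsing_meas (d : ℕ) (p : ℝ) : Measurable (Nsing d p) := by
  unfold Nsing
  exact Measurable.ite (measurableSet_lt measurable_norm measurable_const)
    (measurable_norm.pow_const _) measurable_const

lemma Kfun_meas (d : ℕ) (p q : ℝ) : Measurable (Kfun d p q) := by
  unfold Kfun
  exact ((measurable_norm.pow_const _).div_const _).sub ((measurable_norm.pow_const _).div_const _)

lemma aux_Kfun_le (d : ℕ) {p q : ℝ} (hp2 : p < 0) (hq1 : 0 < q) (hq2 : q ≤ 2) (z : EE d) :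
    Kfun d p q z ≤ (1 + ‖z‖ ^ 3) / q + (1 + Nsing d p z) / (-p) := by
  have hz0 := norm_nonneg z
  have h1 : ‖z‖ ^ q ≤ 1 + ‖z‖ ^ 3 := by
    rcases le_total ‖z‖ 1 with h | h
    · have := Real.rpow_le_one hz0 h hq1.le
      have : 0 ≤ ‖z‖ ^ 3 := by positivity
      linarith
    · have := Real.rpow_le_rpow_of_exponent_le h (show q ≤ ((3 : ℕ) : ℝ) by norm_num; linarith)
      rw [Real.rpow_natCast] at this
      linarith
  have h2 : ‖z‖ ^ p ≤ 1 + Nsing d p z := by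
    unfold Nsing
    split_ifs with h
    · rcases eq_or_lt_of_le hz0 with h0 | h0
      · rw [← h0, Real.zero_rpow hp2.ne, Real.zero_rpow (by linarith)]; norm_num
      · have := Real.rpow_le_rpow_of_exponent_ge h0 h.le (show p - 1 ≤ p by linarith)
        linarith
    · have := Real.rpow_le_one_of_one_le_of_nonpos (not_lt.mp h) hp2.le
      linarith
  have h3 := (div_le_div_iff_of_pos_right hq1).mpr h1
  have h4 := (div_le_div_iff_of_pos_right (neg_pos.mpr hp2)).mpr h2
  unfold Kfun
  rw [div_neg] at h4
  linarith

/-- directional derivative of `K`. -/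
def hder (d : ℕ) (p q : ℝ) (i : Fin d) (z : EE d) : ℝ := z i * (‖z‖ ^ (q - 2) - ‖z‖ ^ (p - 2))

/-- The constant. -/
def c1 (p q : ℝ) : ℝ := 3 / 8 * (1 - (3 / 2 : ℝ) ^ (p - q))

lemma c1_pos {p q : ℝ} (hp2 : p < 0) (hq1 : 0 < q) : 0 < c1 p q := by
  unfold c1
  have := Real.rpow_lt_one_of_one_lt_of_neg (x := (3/2:ℝ)) (by norm_num) (show p - q < 0 by linarith)
  linarith

lemma aux_hder_lower (d : ℕ) {p q : ℝ} (hp2 : p < 0) (hq1 : 0 < q) (hq2 : q ≤ 2) (i : Fin d)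
    (x w : EE d) (hx : 2 < x i) (hne : x - w ≠ 0) :
    ‖x‖ ^ (q - 2) * (c1 p q - (8 * c1 p q + 4) * ‖w‖ ^ 3) - Nsing d p (x - w)
      ≤ hder d p q i (x - w) := by
  have hc := c1_pos hp2 hq1
  have hxi : 2 < ‖x‖ := by
    have := PiLp.norm_apply_le x i
    have h2 := le_abs_self (x i)
    rw [Real.norm_eq_abs] at this
    linarith
  have hwi : |w i| ≤ ‖w‖ := PiLp.norm_apply_le w i
  have hzi : |(x - w) i| ≤ ‖x - w‖ := PiLp.norm_apply_le (x - w) i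
  have hzdef : (x - w) i = x i - w i := rfl
  set z := x - w with hz
  have hzpos : 0 < ‖z‖ := norm_pos_iff.mpr hne
  have hN := Nsing_nonneg d p z
  have hxq : 0 < ‖x‖ ^ (q - 2) := by positivity
  have hw0 := norm_nonneg w
  have hq' : 0 < ‖z‖ ^ (q - 2) := by positivity
  have hp' : 0 < ‖z‖ ^ (p - 2) := by positivity
  have hxle : ‖x‖ ≤ ‖z‖ + ‖w‖ := by
    have := norm_add_le z w
    rwa [hz, sub_add_cancel] at this
  rcases le_or_gt ‖w‖ (1 / 2) with hw | hw
  · have hzi2 : 3 / 2 ≤ z i := by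
      have := (abs_le.mp hwi).2
      rw [hzdef]; linarith
    have hzn : 3 / 2 ≤ ‖z‖ := le_trans hzi2 ((le_abs_self _).trans hzi)
    have hz2 : ‖z‖ ≤ 2 * ‖x‖ := by
      have := norm_sub_le x w
      linarith
    have a1 : ‖x‖ ^ (q - 2) * (1 / 4) ≤ ‖z‖ ^ (q - 2) := by
      calc ‖x‖ ^ (q - 2) * (1 / 4) ≤ ‖x‖ ^ (q - 2) * 2 ^ (q - 2) := by
            gcongr
            calc (1 / 4 : ℝ) = 2 ^ (-2 : ℝ) := by
                  rw [Real.rpow_neg (by norm_num)]; norm_num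
              _ ≤ 2 ^ (q - 2) := Real.rpow_le_rpow_of_exponent_le (by norm_num) (by linarith)
        _ = (2 * ‖x‖) ^ (q - 2) := by
            rw [Real.mul_rpow (by norm_num) (by positivity), mul_comm]
        _ ≤ ‖z‖ ^ (q - 2) := Real.rpow_le_rpow_of_nonpos hzpos hz2 (by linarith)
    have a2 : ‖z‖ ^ (p - 2) ≤ ‖z‖ ^ (q - 2) * (3 / 2 : ℝ) ^ (p - q) := by
      have : ‖z‖ ^ (p - 2) = ‖z‖ ^ (q - 2) * ‖z‖ ^ (p - q) := by
        rw [← Real.rpow_add hzpos]; congr 1; ring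
      rw [this]
      refine mul_le_mul_of_nonneg_left ?_ hq'.le
      exact Real.rpow_le_rpow_of_nonpos (by norm_num) hzn (by linarith)
    have a3 : 0 < 1 - (3 / 2 : ℝ) ^ (p - q) := by
      unfold c1 at hc; linarith
    have a4 : ‖x‖ ^ (q - 2) * (1 / 4) * (1 - (3 / 2 : ℝ) ^ (p - q)) ≤ ‖z‖ ^ (q - 2) - ‖z‖ ^ (p - 2) := by
      have := mul_le_mul_of_nonneg_right a1 a3.le
      linarith
    have a5 : ‖x‖ ^ (q - 2) * c1 p q ≤ hder d p q i z := by
      unfold hder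
      have h0 : 0 ≤ ‖x‖ ^ (q - 2) * (1 / 4) * (1 - (3 / 2 : ℝ) ^ (p - q)) := by positivity
      have := mul_le_mul hzi2 a4 h0 (by linarith)
      refine le_trans (le_of_eq ?_) this
      unfold c1; ring
    have a6 : 0 ≤ ‖x‖ ^ (q - 2) * ((8 * c1 p q + 4) * ‖w‖ ^ 3) := by positivity
    linarith
  · have b0 : 1 ≤ 8 * ‖w‖ ^ 3 := by
      have := pow_le_pow_left₀ (by norm_num) hw.le 3
      linarith
    suffices h : -(‖x‖ ^ (q - 2) * (4 * ‖w‖ ^ 3)) - Nsing d p z ≤ hder d p q i z by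
      have : ‖x‖ ^ (q - 2) * (c1 p q * (1 - 8 * ‖w‖ ^ 3)) ≤ 0 :=
        mul_nonpos_of_nonneg_of_nonpos hxq.le
          (mul_nonpos_of_nonneg_of_nonpos hc.le (by linarith))
      linarith
    have b1 : 0 ≤ ‖x‖ ^ (q - 2) * (4 * ‖w‖ ^ 3) := by positivity
    rcases lt_or_ge ‖z‖ 1 with h1 | h1
    · have e : ‖z‖ ^ (q - 2) ≤ ‖z‖ ^ (p - 2) :=
        Real.rpow_le_rpow_of_exponent_ge hzpos h1.le (by linarith)
      rcases le_or_gt (z i) 0 with h2 | h2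
      · have : 0 ≤ hder d p q i z := mul_nonneg_of_nonpos_of_nonpos h2 (by linarith)
        linarith
      · have e2 : Nsing d p z = ‖z‖ * ‖z‖ ^ (p - 2) := by
          unfold Nsing
          rw [if_pos h1, ← Real.rpow_one_add' hzpos.le (by linarith)]
          congr 1; ring
        have e3 : z i * ‖z‖ ^ (p - 2) ≤ ‖z‖ * ‖z‖ ^ (p - 2) := by
          gcongr
          exact (le_abs_self _).trans hzi
        have e4 : 0 ≤ z i * ‖z‖ ^ (q - 2) := by positivity
        unfold hder
        rw [mul_sub]
        linarith
    · have e : ‖z‖ ^ (p - 2) ≤ ‖z‖ ^ (q - 2) :=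
        Real.rpow_le_rpow_of_exponent_le h1 (by linarith)
      rcases le_or_gt 0 (z i) with h2 | h2
      · have : 0 ≤ hder d p q i z := mul_nonneg h2 (by linarith)
        linarith
      · have hw2 : 2 < w i := by rw [hzdef] at h2; linarith
        have hww : w i ≤ ‖w‖ := (le_abs_self _).trans hwi
        have hw1 : 1 ≤ ‖w‖ := by linarith
        have g1 : ‖x‖ ≤ 2 * ‖w‖ * ‖z‖ := by nlinarith
        have g2 : ‖z‖ ^ (q - 2) ≤ ‖x‖ ^ (q - 2) * (4 * ‖w‖ ^ 2) := by
          have : (2 * ‖w‖) ^ (q - 2) * ‖z‖ ^ (q - 2) ≤ ‖x‖ ^ (q - 2) := by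
            rw [← Real.mul_rpow (by positivity) (by positivity)]
            exact Real.rpow_le_rpow_of_nonpos (by linarith) g1 (by linarith)
          have g3 : (2 * ‖w‖) ^ (2 - q) ≤ 4 * ‖w‖ ^ 2 := by
            have := Real.rpow_le_rpow_of_exponent_le (x := 2 * ‖w‖) (by linarith)
              (show 2 - q ≤ ((2 : ℕ) : ℝ) by norm_num; linarith)
            rw [Real.rpow_natCast] at this
            linarith
          have g4 : (2 * ‖w‖) ^ (2 - q) * (2 * ‖w‖) ^ (q - 2) = 1 := by
            rw [← Real.rpow_add (by linarith)]; simp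
          calc ‖z‖ ^ (q - 2) = (2 * ‖w‖) ^ (2 - q) * ((2 * ‖w‖) ^ (q - 2) * ‖z‖ ^ (q - 2)) := by
                rw [← mul_assoc, g4, one_mul]
            _ ≤ (4 * ‖w‖ ^ 2) * ‖x‖ ^ (q - 2) := by gcongr
            _ = _ := by ring
        have g5 : -‖w‖ ≤ z i := by rw [hzdef]; linarith
        have g6 : -(‖w‖ * ‖z‖ ^ (q - 2)) ≤ z i * ‖z‖ ^ (q - 2) := by nlinarith
        have g7 : ‖w‖ * ‖z‖ ^ (q - 2) ≤ ‖w‖ * (‖x‖ ^ (q - 2) * (4 * ‖w‖ ^ 2)) := by gcongr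
        have g8 : z i * ‖z‖ ^ (p - 2) ≤ 0 := mul_nonpos_of_nonpos_of_nonneg h2.le hp'.le
        unfold hder
        rw [mul_sub]
        nlinarith

lemma aux_hasDeriv (d : ℕ) {p q : ℝ} (hp2 : p < 0) (hq1 : 0 < q) (i : Fin d)
    (v : EE d) (s : ℝ) (hne : v + s • EuclideanSpace.single i (1 : ℝ) ≠ 0) :
    HasDerivAt (fun s : ℝ => Kfun d p q (v + s • EuclideanSpace.single i (1 : ℝ)))
      (hder d p q i (v + s • EuclideanSpace.single i (1 : ℝ))) s := by
  have key : ∀ a : ℝ, a ≠ 0 → HasDerivAt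
      (fun s : ℝ => ‖v + s • EuclideanSpace.single i (1 : ℝ)‖ ^ a / a)
      ((v + s • EuclideanSpace.single i (1 : ℝ)) i *
        ‖v + s • EuclideanSpace.single i (1 : ℝ)‖ ^ (a - 2)) s := by
    intro a ha
    have h1 : HasDerivAt (fun s : ℝ => v + s • EuclideanSpace.single i (1 : ℝ))
        (EuclideanSpace.single i (1 : ℝ)) s := by
      simpa using ((hasDerivAt_id s).smul_const (EuclideanSpace.single i (1 : ℝ))).const_add v
    have h2 := h1.norm_sq
    have hpos : 0 < ‖v + s • EuclideanSpace.single i (1 : ℝ)‖ := norm_pos_iff.mpr hne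
    have h3 := (h2.rpow_const (p := a / 2) (Or.inl (by positivity))).div_const a
    have e1 : ∀ s : ℝ, ∀ b : ℝ, (‖v + s • EuclideanSpace.single i (1 : ℝ)‖ ^ 2) ^ b
        = ‖v + s • EuclideanSpace.single i (1 : ℝ)‖ ^ (2 * b) := by
      intro s b
      rw [← Real.rpow_natCast, ← Real.rpow_mul (norm_nonneg _)]
      norm_num
    simp only [e1] at h3
    rw [show 2 * (a / 2) = a by ring, show 2 * (a / 2 - 1) = a - 2 by ring,
      EuclideanSpace.inner_single_right] at h3
    refine h3.congr_deriv ?_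
    simp
    field_simp
  have := (key q hq1.ne').sub (key p hp2.ne)
  unfold Kfun hder
  rw [mul_sub]
  exact this


lemma aux_circle (ρ : ℝ) (hρ : 0 < ρ) (ω : ℂ) :
    IntervalIntegrable (fun θ : ℝ => Real.log ‖(ρ : ℂ) - circleMap 0 1 θ * ω‖) volume
      0 (2 * Real.pi) ∧
    2 * Real.pi * Real.log ρ ≤
      ∫ θ in (0)..(2 * Real.pi), Real.log ‖(ρ : ℂ) - circleMap 0 1 θ * ω‖ := by
  rcases eq_or_ne ω 0 with rfl | hω
  · simp [abs_of_pos hρ]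
  have hω' : 0 < ‖ω‖ := norm_pos_iff.mpr hω
  set a : ℂ := ρ / ω with ha
  have hi : CircleIntegrable (fun z : ℂ => Real.log ‖z - a‖) 0 1 :=
    circleIntegrable_log_norm_sub_const 1
  have hi' : IntervalIntegrable (fun θ : ℝ => Real.log ‖circleMap 0 1 θ - a‖) volume
      0 (2 * Real.pi) := hi
  have hav := circleAverage_log_norm_sub_const_eq_posLog (a := a)
  have hcount : ∀ᵐ θ : ℝ, circleMap 0 1 θ - a ≠ 0 := by
    have : (circleMap 0 1 ⁻¹' {a}).Countable :=
      (Set.countable_singleton a).preimage_circleMap 0 one_ne_zero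
    filter_upwards [this.ae_notMem volume] with θ hθ h0
    exact hθ (by simpa [sub_eq_zero] using h0)
  have hcong : ∀ᵐ θ : ℝ, Real.log ‖(ρ : ℂ) - circleMap 0 1 θ * ω‖
      = Real.log ‖ω‖ + Real.log ‖circleMap 0 1 θ - a‖ := by
    filter_upwards [hcount] with θ hθ
    rw [← Real.log_mul hω'.ne' (norm_ne_zero_iff.mpr hθ), ← norm_mul, ← norm_neg]
    congr 2
    rw [ha]; field_simp; ring
  have hint : IntervalIntegrable (fun θ : ℝ => Real.log ‖ω‖ + Real.log ‖circleMap 0 1 θ - a‖) volume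
      0 (2 * Real.pi) := (intervalIntegrable_const (μ := volume) (c := Real.log ‖ω‖)).add hi'
  have hcong' : (fun θ : ℝ => Real.log ‖ω‖ + Real.log ‖circleMap 0 1 θ - a‖) =ᵐ[volume]
      (fun θ : ℝ => Real.log ‖(ρ : ℂ) - circleMap 0 1 θ * ω‖) := by
    filter_upwards [hcong] with θ hθ using hθ.symm
  refine ⟨hint.congr_ae (ae_restrict_of_ae hcong'), ?_⟩
  rw [intervalIntegral.integral_congr_ae (g := fun θ : ℝ => Real.log ‖ω‖ + Real.log ‖circleMap 0 1 θ - a‖)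
    (by filter_upwards [hcong] with θ hθ _ using hθ)]
  rw [intervalIntegral.integral_add (intervalIntegrable_const) hi']
  unfold Real.circleAverage at hav
  have hpi := Real.pi_pos
  have h2 : ∫ θ in (0)..(2 * Real.pi), Real.log ‖circleMap 0 1 θ - a‖
      = 2 * Real.pi * Real.posLog ‖a‖ := by
    rw [← hav, smul_eq_mul]
    field_simp
  rw [h2, intervalIntegral.integral_const, smul_eq_mul, sub_zero]
  have h3 : Real.log ‖a‖ ≤ Real.posLog ‖a‖ := le_max_right _ _
  have h4 : Real.log ‖a‖ = Real.log ρ - Real.log ‖ω‖ := by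
    rw [ha, norm_div, Real.log_div (by simpa using hρ.ne') hω'.ne']
    simp
  nlinarith

/-- Rotation in the plane spanned by `e`, `u`. -/
def rotFun (d : ℕ) (e u : EE d) (θ : ℝ) (w : EE d) : EE d :=
  w + ((Real.cos θ - 1) * inner ℝ e w - Real.sin θ * inner ℝ u w) • e
    + (Real.sin θ * inner ℝ e w + (Real.cos θ - 1) * inner ℝ u w) • u

lemma rotFun_norm (d : ℕ) (e u : EE d) (he : ‖e‖ = 1) (hu : ‖u‖ = 1) (heu : inner ℝ e u = 0)
    (θ : ℝ) (w : EE d) : ‖rotFun d e u θ w‖ = ‖w‖ := by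
  have hsq : ‖rotFun d e u θ w‖ ^ 2 = ‖w‖ ^ 2 := by
    unfold rotFun
    set a := inner ℝ e w with ha
    set b := inner ℝ u w with hb
    set α := (Real.cos θ - 1) * a - Real.sin θ * b with hα
    set β := Real.sin θ * a + (Real.cos θ - 1) * b with hβ
    rw [norm_add_sq_real, norm_add_sq_real, inner_add_left, inner_smul_left, inner_smul_right,
      inner_smul_right, inner_smul_right, norm_smul, norm_smul, he, hu, heu,
      real_inner_comm, real_inner_comm u w, ← ha, ← hb]
    simp only [Real.norm_eq_abs, mul_one, sq_abs, mul_zero, add_zero]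
    rw [hα, hβ]
    linear_combination (a ^ 2 + b ^ 2) * (Real.sin_sq_add_cos_sq θ)
  exact (pow_left_inj₀ (norm_nonneg _) (norm_nonneg _) two_ne_zero).mp hsq

def rotIso (d : ℕ) (e u : EE d) (he : ‖e‖ = 1) (hu : ‖u‖ = 1) (heu : inner ℝ e u = 0)
    (θ : ℝ) : (EE d) ≃ₗᵢ[ℝ] (EE d) :=
  LinearIsometry.toLinearIsometryEquiv
    { toFun := rotFun d e u θ
      map_add' := by
        intro x y
        simp only [rotFun, inner_add_right]
        module
      map_smul' := by
        intro c x
        simp only [rotFun, inner_smul_right, RingHom.id_apply]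
        module
      norm_map' := rotFun_norm d e u he hu heu θ } rfl

lemma aux_bessel (d : ℕ) (e u : EE d) (he : ‖e‖ = 1) (hu : ‖u‖ = 1) (heu : inner ℝ e u = 0)
    (v : EE d) : (inner ℝ e v) ^ 2 + (inner ℝ u v) ^ 2 ≤ ‖v‖ ^ 2 := by
  have h := sq_nonneg ‖v - ((inner ℝ e v) • e + (inner ℝ u v) • u)‖
  rw [norm_sub_sq_real, norm_add_sq_real, inner_add_right, inner_smul_left, inner_smul_right,
    inner_smul_right, inner_smul_right, norm_smul, norm_smul, he, hu, heu,
    real_inner_comm e v, real_inner_comm u v] at h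
  simp only [Real.norm_eq_abs, mul_one, sq_abs, mul_zero, add_zero] at h
  nlinarith

lemma aux_log_average (d : ℕ) (hd : 2 ≤ d) (μ : Measure (EE d)) [IsProbabilityMeasure μ]
    (hinv : ∀ R : (EE d) ≃ₗᵢ[ℝ] (EE d), μ.map R = μ) (x : EE d) (hx : x ≠ 0)
    (hint : Integrable (fun w => Real.log ‖x - w‖) μ) :
    Real.log ‖x‖ ≤ ∫ w, Real.log ‖x - w‖ ∂μ := by
  have hx' : 0 < ‖x‖ := norm_pos_iff.mpr hx
  set e : EE d := ‖x‖⁻¹ • x with he_def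
  have he : ‖e‖ = 1 := by
    rw [he_def, norm_smul, norm_inv, norm_norm, inv_mul_cancel₀ hx'.ne']
  have hxe : x = ‖x‖ • e := by
    rw [he_def, smul_smul, mul_inv_cancel₀ hx'.ne', one_smul]
  obtain ⟨u, hu, heu⟩ : ∃ u : EE d, ‖u‖ = 1 ∧ inner ℝ e u = 0 := by
    have hlt : Module.finrank ℝ (ℝ ∙ e) < Module.finrank ℝ (EE d) := by
      rw [finrank_span_singleton (by intro h; simp [h] at he), finrank_euclideanSpace_fin]; omega
    have hne : (ℝ ∙ e)ᗮ ≠ ⊥ := by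
      intro h
      rw [Submodule.orthogonal_eq_bot_iff] at h
      rw [h, finrank_top] at hlt
      exact lt_irrefl _ hlt
    obtain ⟨v, hv, hv0⟩ := Submodule.exists_mem_ne_zero_of_ne_bot hne
    have hv' : 0 < ‖v‖ := norm_pos_iff.mpr hv0
    refine ⟨‖v‖⁻¹ • v, ?_, ?_⟩
    · rw [norm_smul, norm_inv, norm_norm, inv_mul_cancel₀ hv'.ne']
    · rw [inner_smul_right, Submodule.mem_orthogonal_singleton_iff_inner_right.mp hv, mul_zero]
  set F : ℝ → (EE d) → ℝ := fun θ w => Real.log ‖x - rotFun d e u θ w‖ with hF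
  have hmeas : Measurable (Function.uncurry F) := by
    apply Real.measurable_log.comp
    apply Continuous.measurable
    unfold rotFun
    fun_prop
  have hmp : ∀ θ, MeasurePreserving (rotFun d e u θ) μ μ := by
    intro θ
    refine ⟨(rotIso d e u he hu heu θ).continuous.measurable, hinv (rotIso d e u he hu heu θ)⟩
  have hmeas0 : AEStronglyMeasurable (fun w => Real.log ‖x - w‖) μ := hint.1
  have hFint : ∀ θ, Integrable (F θ) μ := fun θ => (hmp θ).integrable_comp_of_integrable hint
  have hmeq : ∀ (g : (EE d) → ℝ), Measurable g → ∀ θ, ∫ w, g (rotFun d e u θ w) ∂μ = ∫ w, g w ∂μ := by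
    intro g hg θ
    conv_rhs => rw [← (hmp θ).map_eq]
    rw [integral_map (hmp θ).aemeasurable hg.aestronglyMeasurable]
  have hlm : Measurable (fun w : EE d => Real.log ‖x - w‖) :=
    Real.measurable_log.comp (by fun_prop)
  have hFeq : ∀ θ, ∫ w, F θ w ∂μ = ∫ w, Real.log ‖x - w‖ ∂μ := fun θ => hmeq _ hlm θ
  have hFeq' : ∀ θ, ∫ w, ‖F θ w‖ ∂μ = ∫ w, ‖Real.log ‖x - w‖‖ ∂μ := fun θ => hmeq _ hlm.norm θ
  set I : Measure ℝ := volume.restrict (Set.Ioc 0 (2 * Real.pi)) with hI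
  have hprod : Integrable (Function.uncurry F) (I.prod μ) := by
    rw [integrable_prod_iff hmeas.aestronglyMeasurable]
    refine ⟨Eventually.of_forall hFint, ?_⟩
    simp only [Function.uncurry_apply_pair, hFeq']
    exact integrable_const _
  have hpi := Real.pi_pos
  have hsw := integral_integral_swap (μ := I) (ν := μ) (f := F) hprod
  have hL : ∫ θ, ∫ w, F θ w ∂μ ∂I = 2 * Real.pi * ∫ w, Real.log ‖x - w‖ ∂μ := by
    simp only [hFeq]
    rw [integral_const, smul_eq_mul, hI]
    simp [Measure.real, hpi.le]
  have hR : ∀ᵐ w ∂μ, 2 * Real.pi * Real.log ‖x‖ ≤ ∫ θ, F θ w ∂I := by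
    filter_upwards [hprod.prod_left_ae] with w hw
    set a := inner ℝ e w with ha
    set b := inner ℝ u w with hb
    set ω : ℂ := ⟨a, b⟩ with hω
    obtain ⟨h1, h2⟩ := aux_circle ‖x‖ hx' ω
    refine h2.trans ?_
    rw [intervalIntegral.integral_of_le (by positivity)]
    have hsing : ∀ᵐ θ : ℝ, ‖((‖x‖ : ℝ) : ℂ) - circleMap 0 1 θ * ω‖ ≠ 0 := by
      rcases eq_or_ne ω 0 with h0 | h0
      · rw [h0]; simp [hx]
      · have : (circleMap 0 1 ⁻¹' {((‖x‖ : ℝ) : ℂ) / ω}).Countable :=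
          (Set.countable_singleton _).preimage_circleMap 0 one_ne_zero
        filter_upwards [this.ae_notMem volume] with θ hθ h
        apply hθ
        rw [norm_eq_zero, sub_eq_zero] at h
        simp only [Set.mem_preimage, Set.mem_singleton_iff]
        rw [h]; field_simp
    refine integral_mono_ae ((intervalIntegrable_iff_integrableOn_Ioc_of_le (by positivity)).mp h1)
      hw ?_
    filter_upwards [ae_restrict_of_ae hsing] with θ hθ
    refine Real.log_le_log (lt_of_le_of_ne (norm_nonneg _) (Ne.symm hθ)) ?_
    refine le_of_sq_le_sq ?_ (norm_nonneg _)
    refine le_trans (le_of_eq ?_) (aux_bessel d e u he hu heu _)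
    have hue : inner ℝ u e = 0 := by rw [real_inner_comm]; exact heu
    have hee : inner ℝ e e = (1 : ℝ) := by rw [real_inner_self_eq_norm_sq, he]; norm_num
    have huu : inner ℝ u u = (1 : ℝ) := by rw [real_inner_self_eq_norm_sq, hu]; norm_num
    have i1 : inner ℝ e x = ‖x‖ := by
      conv_lhs => rw [hxe]
      rw [inner_smul_right, hee, mul_one]
    have i2 : inner ℝ u x = 0 := by
      conv_lhs => rw [hxe]
      rw [inner_smul_right, hue, mul_zero]
    simp only [rotFun, inner_sub_right, inner_add_right, inner_smul_right, i1, i2, hue, hee, huu,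
      heu, ← ha, ← hb]
    rw [← Complex.normSq_eq_norm_sq, Complex.normSq_apply]
    simp [circleMap, hω, Complex.exp_re, Complex.exp_im]
    ring
  have hfin : 2 * Real.pi * Real.log ‖x‖ ≤ ∫ w, ∫ θ, F θ w ∂I ∂μ := by
    have := integral_mono_ae (integrable_const (μ := μ) (2 * Real.pi * Real.log ‖x‖))
      hprod.integral_prod_right hR
    simpa using this
  rw [← hsw, hL] at hfin
  exact le_of_mul_le_mul_left hfin (by positivity)


lemma mol_bdd (d : ℕ) {φ : (EE d) → ℝ} (hφ : IsMollifier d φ) :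
    ∃ B : ℝ, 0 < B ∧ ∀ x, φ x ≤ B := by
  obtain ⟨hs, hr, h0, h1, C, hC, l, hl, hb⟩ := hφ
  obtain ⟨D, hD⟩ := (isCompact_closedBall (0 : EE d) 1).exists_bound_of_continuousOn
    hs.continuous.continuousOn
  refine ⟨max D C, lt_max_of_lt_right hC, fun x => ?_⟩
  rcases le_or_gt ‖x‖ 1 with h | h
  · exact le_max_of_le_left ((le_abs_self _).trans (hD x (by simpa using h)))
  · refine le_max_of_le_right ((hb x (by rintro rfl; simp at h; linarith)).trans ?_)
    have : ‖x‖ ^ (-l) ≤ 1 := Real.rpow_le_one_of_one_le_of_nonpos h.le (by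
      have := le_max_right (2 * (d : ℝ) + 1) 4; linarith)
    nlinarith

lemma mol_integrable (d : ℕ) {φ : (EE d) → ℝ} (hφ : IsMollifier d φ) : Integrable φ := by
  by_contra h
  have := integral_undef h
  rw [hφ.2.2.2.1] at this
  norm_num at this

lemma mol_moment (d : ℕ) (hd : 3 ≤ d) {φ : (EE d) → ℝ} (hφ : IsMollifier d φ) :
    Integrable (fun y => ‖y‖ ^ 3 * φ y) := by
  obtain ⟨B, hB, hbd⟩ := mol_bdd d hφ
  obtain ⟨hs, hr, h0, h1, C, hC, l, hl, hb⟩ := hφ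
  have hdr : (3 : ℝ) ≤ d := by exact_mod_cast hd
  have hl2 : 2 * (d : ℝ) + 1 ≤ l := (le_max_left _ _).trans hl
  have hI : Integrable (fun y : EE d => (1 + ‖y‖) ^ (-((d : ℝ) + 1))) :=
    integrable_one_add_norm (by rw [finrank_euclideanSpace_fin]; linarith)
  refine Integrable.mono' (hI.const_mul ((B + C) * 2 ^ ((d : ℝ) + 1)))
    ((by fun_prop : Continuous fun y : EE d => ‖y‖ ^ 3).mul hs.continuous).aestronglyMeasurable ?_
  refine Eventually.of_forall fun y => ?_
  have hn := norm_nonneg y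
  have hy0 := h0 y
  rw [Real.norm_of_nonneg (by positivity)]
  rcases le_or_gt ‖y‖ 1 with h | h
  · have e1 : ‖y‖ ^ 3 ≤ 1 := pow_le_one₀ hn h
    have e2 : (2 : ℝ) ^ (-((d : ℝ) + 1)) ≤ (1 + ‖y‖) ^ (-((d : ℝ) + 1)) :=
      Real.rpow_le_rpow_of_nonpos (by linarith) (by linarith) (by linarith)
    have e3 : (2 : ℝ) ^ ((d : ℝ) + 1) * (2 : ℝ) ^ (-((d : ℝ) + 1)) = 1 := by
      rw [← Real.rpow_add (by norm_num)]; simp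
    calc ‖y‖ ^ 3 * φ y ≤ 1 * (B + C) := by
          gcongr
          linarith [hbd y]
      _ = (B + C) * ((2 : ℝ) ^ ((d : ℝ) + 1) * (2 : ℝ) ^ (-((d : ℝ) + 1))) := by rw [e3]; ring
      _ ≤ (B + C) * ((2 : ℝ) ^ ((d : ℝ) + 1) * (1 + ‖y‖) ^ (-((d : ℝ) + 1))) := by gcongr
      _ = _ := by ring
  · have hy : y ≠ 0 := by rintro rfl; simp at h; linarith
    have hpos : 0 < ‖y‖ := by linarith
    have e1 := hb y hy
    have e2 : ‖y‖ ^ 3 * ‖y‖ ^ (-l) ≤ ‖y‖ ^ (-((d : ℝ) + 1)) := by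
      rw [← Real.rpow_natCast, ← Real.rpow_add hpos]
      exact Real.rpow_le_rpow_of_exponent_le h.le (by push_cast; linarith)
    have e3 : ‖y‖ ^ (-((d : ℝ) + 1)) ≤ (2 : ℝ) ^ ((d : ℝ) + 1) * (1 + ‖y‖) ^ (-((d : ℝ) + 1)) := by
      have : (2 * ‖y‖) ^ (-((d : ℝ) + 1)) ≤ (1 + ‖y‖) ^ (-((d : ℝ) + 1)) :=
        Real.rpow_le_rpow_of_nonpos (by linarith) (by linarith) (by linarith)
      rw [Real.mul_rpow (by norm_num) hn] at this
      have e3 : (2 : ℝ) ^ ((d : ℝ) + 1) * (2 : ℝ) ^ (-((d : ℝ) + 1)) = 1 := by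
        rw [← Real.rpow_add (by norm_num)]; simp
      calc ‖y‖ ^ (-((d : ℝ) + 1)) = (2 : ℝ) ^ ((d : ℝ) + 1) * ((2 : ℝ) ^ (-((d : ℝ) + 1))
            * ‖y‖ ^ (-((d : ℝ) + 1))) := by rw [← mul_assoc, e3, one_mul]
        _ ≤ _ := by gcongr
    calc ‖y‖ ^ 3 * φ y ≤ ‖y‖ ^ 3 * (C * ‖y‖ ^ (-l)) := by gcongr
      _ = C * (‖y‖ ^ 3 * ‖y‖ ^ (-l)) := by ring
      _ ≤ (B + C) * ((2 : ℝ) ^ ((d : ℝ) + 1) * (1 + ‖y‖) ^ (-((d : ℝ) + 1))) := by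
          exact mul_le_mul (by linarith) (e2.trans e3) (by positivity) (by linarith)
      _ = _ := by ring

/-- The measure with density `φ_ε`. -/
def nuM (d : ℕ) (φ : (EE d) → ℝ) (ε : ℝ) : Measure (EE d) :=
  volume.withDensity (fun y => ENNReal.ofReal (scaled d φ ε y))

/-- The measure with density `φ_ε * φ_ε`. -/
def muM (d : ℕ) (φ : (EE d) → ℝ) (ε : ℝ) : Measure (EE d) :=
  Measure.conv (nuM d φ ε) (nuM d φ ε)

section

lemma scaled_cont (d : ℕ) {φ : (EE d) → ℝ}
    (hφ : IsMollifier d φ) {ε : ℝ} : Continuous (scaled d φ ε) := by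
  have := hφ.1.continuous
  unfold scaled
  fun_prop

lemma scaled_nonneg (d : ℕ) {φ : (EE d) → ℝ}
    (hφ : IsMollifier d φ) {ε : ℝ} (hε : 0 < ε) (x : EE d) : 0 ≤ scaled d φ ε x := by
  have := hφ.2.2.1 (ε⁻¹ • x)
  unfold scaled
  positivity

lemma scaled_integrable (d : ℕ) {φ : (EE d) → ℝ}
    (hφ : IsMollifier d φ) {ε : ℝ} (hε : 0 < ε) : Integrable (scaled d φ ε) := by
  unfold scaled
  exact ((mol_integrable d hφ).comp_smul (inv_ne_zero hε.ne')).const_mul _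

lemma scaled_integral_s7 (d : ℕ) {φ : (EE d) → ℝ}
    (hφ : IsMollifier d φ) {ε : ℝ} (hε : 0 < ε) : ∫ x, scaled d φ ε x = 1 := by
  unfold scaled
  rw [integral_const_mul, Measure.integral_comp_inv_smul_of_nonneg _ _ hε.le, hφ.2.2.2.1,
    finrank_euclideanSpace_fin]
  simp [hε.ne']

lemma nu_prob (d : ℕ) {φ : (EE d) → ℝ}
    (hφ : IsMollifier d φ) {ε : ℝ} (hε : 0 < ε) : IsProbabilityMeasure (nuM d φ ε) := by
  constructor
  rw [nuM, withDensity_apply _ MeasurableSet.univ, Measure.restrict_univ,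
    ← ofReal_integral_eq_lintegral_ofReal (scaled_integrable d hφ hε)
      (Eventually.of_forall (scaled_nonneg d hφ hε)), scaled_integral_s7 d hφ hε]
  simp

lemma scaled_meas (d : ℕ) {φ : (EE d) → ℝ}
    (hφ : IsMollifier d φ) {ε : ℝ} : Measurable (fun y => ENNReal.ofReal (scaled d φ ε y)) :=
  (scaled_cont d hφ).measurable.ennreal_ofReal

lemma nu_moment (d : ℕ) {φ : (EE d) → ℝ}
    (hφ : IsMollifier d φ) {ε : ℝ} (hε : 0 < ε) (hd : 3 ≤ d) : Integrable (fun y => ‖y‖ ^ 3) (nuM d φ ε) ∧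
    ∫ y, ‖y‖ ^ 3 ∂(nuM d φ ε) = ε ^ 3 * ∫ y, ‖y‖ ^ 3 * φ y := by
  have e : ∀ y : EE d, (ENNReal.ofReal (scaled d φ ε y)).toReal • ‖y‖ ^ 3
      = (ε ^ d)⁻¹ * ε ^ 3 * (‖ε⁻¹ • y‖ ^ 3 * φ (ε⁻¹ • y)) := by
    intro y
    rw [ENNReal.toReal_ofReal (scaled_nonneg d hφ hε y), scaled, norm_smul, norm_inv,
      Real.norm_of_nonneg hε.le, smul_eq_mul]
    field_simp
  constructor
  · rw [nuM, integrable_withDensity_iff_integrable_smul' (scaled_meas d hφ) (by simp)]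
    simp only [e]
    exact ((mol_moment d hd hφ).comp_smul (inv_ne_zero hε.ne')).const_mul _
  · rw [nuM, integral_withDensity_eq_integral_toReal_smul (scaled_meas d hφ) (by simp)]
    simp only [e]
    rw [integral_const_mul,
      Measure.integral_comp_inv_smul_of_nonneg volume (fun y : EE d => ‖y‖ ^ 3 * φ y) hε.le,
      finrank_euclideanSpace_fin, smul_eq_mul]
    field_simp

lemma nu_inv (d : ℕ) {φ : (EE d) → ℝ}
    (hφ : IsMollifier d φ) {ε : ℝ} (R : (EE d) ≃ₗᵢ[ℝ] (EE d)) : (nuM d φ ε).map R = nuM d φ ε := by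
  ext s hs
  have hR : Measurable R := R.continuous.measurable
  rw [Measure.map_apply hR hs, nuM, withDensity_apply _ (hR hs), withDensity_apply _ hs]
  rw [← (R.measurePreserving).setLIntegral_comp_preimage hs (scaled_meas d hφ)]
  refine lintegral_congr fun y => ?_
  congr 1
  unfold scaled
  congr 1
  apply hφ.2.1
  rw [norm_smul, norm_smul, R.norm_map]

lemma mu_prob (d : ℕ) {φ : (EE d) → ℝ}
    (hφ : IsMollifier d φ) {ε : ℝ} (hε : 0 < ε) : IsProbabilityMeasure (muM d φ ε) := by
  have := nu_prob d hφ hε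
  unfold muM; infer_instance

lemma mu_inv (d : ℕ) {φ : (EE d) → ℝ}
    (hφ : IsMollifier d φ) {ε : ℝ} (hε : 0 < ε) (R : (EE d) ≃ₗᵢ[ℝ] (EE d)) : (muM d φ ε).map R = muM d φ ε := by
  have := nu_prob d hφ hε
  have h := Measure.map_conv_continuousLinearMap (μ := nuM d φ ε) (ν := nuM d φ ε)
    (R.toContinuousLinearEquiv : (EE d) →L[ℝ] (EE d))
  have e : ⇑(R.toContinuousLinearEquiv : (EE d) →L[ℝ] (EE d)) = R := rfl
  rw [e, nu_inv d hφ R] at h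
  exact h

lemma mu_ac (d : ℕ) {φ : (EE d) → ℝ}
    (hφ : IsMollifier d φ) {ε : ℝ} (hε : 0 < ε) : muM d φ ε ≪ volume := by
  have := nu_prob d hφ hε
  exact Measure.conv_absolutelyContinuous (withDensity_absolutelyContinuous _ _)

lemma mu_moment (d : ℕ) {φ : (EE d) → ℝ}
    (hφ : IsMollifier d φ) {ε : ℝ} (hε : 0 < ε) (hd : 3 ≤ d) : Integrable (fun y => ‖y‖ ^ 3) (muM d φ ε) ∧
    ∫ y, ‖y‖ ^ 3 ∂(muM d φ ε) ≤ 8 * ε ^ 3 * ∫ y, ‖y‖ ^ 3 * φ y := by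
  have := nu_prob d hφ hε
  obtain ⟨h1, h2⟩ := nu_moment d hφ hε hd
  set ν := nuM d φ ε with hν
  have hm : AEStronglyMeasurable (fun y : EE d => ‖y‖ ^ 3) (ν.conv ν) :=
    (by fun_prop : Continuous fun y : EE d => ‖y‖ ^ 3).aestronglyMeasurable
  have hP : Integrable (fun z : (EE d) × (EE d) => 4 * (‖z.1‖ ^ 3 + ‖z.2‖ ^ 3)) (ν.prod ν) :=
    ((h1.comp_fst ν).add (h1.comp_snd ν)).const_mul 4
  have hle : ∀ y z : EE d, ‖y + z‖ ^ 3 ≤ 4 * (‖y‖ ^ 3 + ‖z‖ ^ 3) := by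
    intro y z
    have a := norm_add_le y z
    have b := pow_le_pow_left₀ (norm_nonneg _) a 3
    refine b.trans ?_
    have hy := norm_nonneg y
    have hz := norm_nonneg z
    nlinarith [mul_nonneg (add_nonneg hy hz) (sq_nonneg (‖y‖ - ‖z‖))]
  have hQ : Integrable (fun z : (EE d) × (EE d) => ‖z.1 + z.2‖ ^ 3) (ν.prod ν) := by
    refine hP.mono' (by fun_prop : Continuous _).aestronglyMeasurable
      (Eventually.of_forall fun z => ?_)
    rw [Real.norm_of_nonneg (by positivity)]
    exact hle _ _
  have hI : Integrable (fun y : EE d => ‖y‖ ^ 3) (ν.conv ν) := by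
    unfold Measure.conv
    rw [integrable_map_measure hm (by fun_prop)]
    exact hQ
  refine ⟨hI, ?_⟩
  unfold muM
  rw [← hν]
  unfold Measure.conv
  rw [integral_map (by fun_prop) hm]
  refine (integral_mono hQ hP (fun z => hle _ _)).trans (le_of_eq ?_)
  rw [integral_const_mul, integral_add (h1.comp_fst ν) (h1.comp_snd ν), integral_fun_fst (μ := ν) (ν := ν) (fun y => ‖y‖ ^ 3),
    integral_fun_snd (μ := ν) (ν := ν) (fun y => ‖y‖ ^ 3), h2]
  simp
  ring

end

lemma Nsing_lint (d : ℕ) (hd : 3 ≤ d) {p : ℝ} (hp1 : 2 - (d : ℝ) ≤ p) :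
    ∫⁻ z, ENNReal.ofReal (Nsing d p z) < ⊤ := by
  have hI : IntegrableOn (fun z : EE d => ‖z‖ ^ (p - 1)) (Metric.ball 0 1) := by
    refine integrableOn_ball_of_norm_le_rpow (C := 1) (α := 1 - p) ?_ ?_ ?_ ?_
    · rw [finrank_euclideanSpace_fin]; omega
    · rw [finrank_euclideanSpace_fin]; linarith
    · refine Eventually.of_forall fun z => ?_
      rw [Real.norm_of_nonneg (by positivity), one_mul, neg_sub]
    · exact (measurable_norm.pow_const _).aestronglyMeasurable
  have hJ : Integrable (Nsing d p) := by
    rw [← integrable_indicator_iff measurableSet_ball] at hI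
    refine hI.congr (Eventually.of_forall fun z => ?_)
    simp [Nsing, Set.indicator]
  exact hJ.lintegral_lt_top

section

lemma nu_N_le (d : ℕ) {φ : (EE d) → ℝ}
    (hφ : IsMollifier d φ) {ε : ℝ} {p : ℝ} (S : Set (EE d)) (hS : MeasurableSet S) (b : ℝ)
    (hb : ∀ z ∈ S, scaled d φ ε z ≤ b) (a : EE d) :
    ∫⁻ z, S.indicator (fun z => ENNReal.ofReal (Nsing d p (a - z))) z ∂(nuM d φ ε)
      ≤ ENNReal.ofReal b * ∫⁻ z, ENNReal.ofReal (Nsing d p z) := by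
  have hN : Measurable (fun z => ENNReal.ofReal (Nsing d p (a - z))) :=
    ((Nsing_meas d p).comp (measurable_const.sub measurable_id)).ennreal_ofReal
  rw [nuM, lintegral_withDensity_eq_lintegral_mul _ (scaled_meas d hφ) (hN.indicator hS)]
  rw [← lintegral_sub_left_eq_self (fun z => ENNReal.ofReal (Nsing d p z)) a,
    ← lintegral_const_mul _ hN]
  refine lintegral_mono fun z => ?_
  simp only [Pi.mul_apply, Set.indicator]
  split_ifs with h
  · gcongr
    exact hb z h
  · simp

lemma mu_N_bdd (d : ℕ) {φ : (EE d) → ℝ}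
    (hφ : IsMollifier d φ) {ε : ℝ} (hε : 0 < ε) (hd : 3 ≤ d) {p : ℝ} (hp1 : 2 - (d : ℝ) ≤ p) : ∃ A : ℝ≥0∞, A < ⊤ ∧ ∀ x : EE d,
    ∫⁻ w, ENNReal.ofReal (Nsing d p (x - w)) ∂(muM d φ ε) ≤ A := by
  obtain ⟨B, hB, hbd⟩ := mol_bdd d hφ
  have := nu_prob d hφ hε
  refine ⟨ENNReal.ofReal ((ε ^ d)⁻¹ * B) * ∫⁻ z, ENNReal.ofReal (Nsing d p z),
    ENNReal.mul_lt_top ENNReal.ofReal_lt_top (Nsing_lint d hd hp1), fun x => ?_⟩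
  have hN : Measurable (fun z => ENNReal.ofReal (Nsing d p (x - z))) :=
    ((Nsing_meas d p).comp (measurable_const.sub measurable_id)).ennreal_ofReal
  rw [muM, Measure.lintegral_conv hN]
  calc _ ≤ ∫⁻ _ : EE d, (ENNReal.ofReal ((ε ^ d)⁻¹ * B) *
        (∫⁻ z, ENNReal.ofReal (Nsing d p z))) ∂(nuM d φ ε) := by
        refine lintegral_mono fun y => ?_
        have := nu_N_le d hφ (p := p) (ε := ε) Set.univ MeasurableSet.univ ((ε ^ d)⁻¹ * B)
          (fun z _ => by unfold scaled; gcongr; exact hbd _) (x - y)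
        simpa [sub_sub] using this
    _ = _ := by simp


end

lemma lint_split {X : Type*} [MeasurableSpace X] (ν : Measure X) [SFinite ν] (F G : X → X → ℝ≥0∞)
    (hG : Measurable (fun q : X × X => G q.1 q.2)) :
    ∫⁻ y, ∫⁻ z, (F y z + G y z) ∂ν ∂ν = ∫⁻ y, ∫⁻ z, F y z ∂ν ∂ν + ∫⁻ y, ∫⁻ z, G y z ∂ν ∂ν := by
  have h1 : Measurable (fun y => ∫⁻ z, G y z ∂ν) := hG.lintegral_prod_right
  rw [← lintegral_add_right _ h1]
  refine lintegral_congr fun y => ?_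
  have h2 : Measurable (fun z => G y z) := hG.comp measurable_prodMk_left
  rw [lintegral_add_right _ h2]

lemma mu_N_tail (d : ℕ) (hd : 3 ≤ d) {p : ℝ} (hp1 : 2 - (d : ℝ) ≤ p) {φ : (EE d) → ℝ}
    (hφ : IsMollifier d φ) : ∃ A : ℝ, 0 ≤ A ∧ ∀ ε : ℝ, 0 < ε → ε ≤ 1 → ∀ x : EE d, 2 ≤ ‖x‖ →
    ∫⁻ w, ENNReal.ofReal (Nsing d p (x - w)) ∂(muM d φ ε) ≤
      ENNReal.ofReal (A * ε * ‖x‖ ^ (-2 : ℝ)) := by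
  have hφ' := hφ
  obtain ⟨hs, hr, h0, h1, C, hC, l, hl, hb⟩ := hφ'
  have hdr : (3 : ℝ) ≤ d := by exact_mod_cast hd
  have hl2 : 2 * (d : ℝ) + 1 ≤ l := (le_max_left _ _).trans hl
  set n := ∫⁻ z, ENNReal.ofReal (Nsing d p z) with hn
  have hnfin : n < ⊤ := Nsing_lint d hd hp1
  refine ⟨2 * (C * (2 : ℝ) ^ (l - 2) * 16) * n.toReal, by positivity, fun ε hε hε1 x hx => ?_⟩
  have := nu_prob d hφ hε
  have hN : Measurable (fun z => ENNReal.ofReal (Nsing d p (x - z))) :=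
    ((Nsing_meas d p).comp (measurable_const.sub measurable_id)).ennreal_ofReal
  set S : Set (EE d) := {z | ‖x‖ / 4 ≤ ‖z‖} with hS
  have hSm : MeasurableSet S := measurableSet_le measurable_const measurable_norm
  set b : ℝ := C * (2 : ℝ) ^ (l - 2) * 16 * ε * ‖x‖ ^ (-2 : ℝ) with hbdef
  have hbS : ∀ z ∈ S, scaled d φ ε z ≤ b := by
    intro z hz
    have hz' : ‖x‖ / 4 ≤ ‖z‖ := hz
    have hzpos : 0 < ‖z‖ := by linarith
    have hz2 : 1 / 2 ≤ ‖z‖ := by linarith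
    have hne : ε⁻¹ • z ≠ 0 := smul_ne_zero (inv_ne_zero hε.ne') (norm_pos_iff.mp hzpos)
    have e1 := hb _ hne
    rw [norm_smul, norm_inv, Real.norm_of_nonneg hε.le, Real.mul_rpow (by positivity) hzpos.le,
      Real.inv_rpow hε.le, ← Real.rpow_neg hε.le, neg_neg] at e1
    have e2 : (ε ^ d)⁻¹ * ε ^ l ≤ ε := by
      rw [← Real.rpow_natCast, ← Real.rpow_neg hε.le, ← Real.rpow_add hε]
      calc ε ^ (-(d : ℝ) + l) ≤ ε ^ (1 : ℝ) :=
            Real.rpow_le_rpow_of_exponent_ge hε hε1 (by linarith)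
        _ = ε := Real.rpow_one _
    have e3 : ‖z‖ ^ (-l) ≤ (2 : ℝ) ^ (l - 2) * (16 * ‖x‖ ^ (-2 : ℝ)) := by
      have f1 : ‖z‖ ^ (-l) = ‖z‖ ^ (-(l - 2)) * ‖z‖ ^ (-2 : ℝ) := by
        rw [← Real.rpow_add hzpos]; congr 1; ring
      have f2 : ‖z‖ ^ (-(l - 2)) ≤ (1 / 2 : ℝ) ^ (-(l - 2)) :=
        Real.rpow_le_rpow_of_nonpos (by norm_num) hz2 (by linarith)
      have f3 : (1 / 2 : ℝ) ^ (-(l - 2)) = 2 ^ (l - 2) := by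
        rw [one_div, Real.inv_rpow (by norm_num), Real.rpow_neg (by norm_num), inv_inv]
      have f4 : ‖z‖ ^ (-2 : ℝ) ≤ 16 * ‖x‖ ^ (-2 : ℝ) := by
        have : ‖z‖ ^ (-2 : ℝ) ≤ (‖x‖ / 4) ^ (-2 : ℝ) :=
          Real.rpow_le_rpow_of_nonpos (by linarith) hz' (by norm_num)
        refine this.trans (le_of_eq ?_)
        rw [Real.div_rpow (norm_nonneg _) (by norm_num), Real.rpow_neg (x := 4) (by norm_num)]
        norm_num
        ring
      rw [f1, ← f3]
      gcongr
    unfold scaled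
    calc (ε ^ d)⁻¹ * φ (ε⁻¹ • z) ≤ (ε ^ d)⁻¹ * (C * (ε ^ l * ‖z‖ ^ (-l))) := by gcongr
      _ = C * ((ε ^ d)⁻¹ * ε ^ l) * ‖z‖ ^ (-l) := by ring
      _ ≤ C * ε * ((2 : ℝ) ^ (l - 2) * (16 * ‖x‖ ^ (-2 : ℝ))) := by gcongr
      _ = b := by rw [hbdef]; ring
  have key : ∀ a, ∫⁻ z, S.indicator (fun z => ENNReal.ofReal (Nsing d p (a - z))) z ∂(nuM d φ ε)
      ≤ ENNReal.ofReal b * n := fun a => nu_N_le d hφ S hSm b hbS a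
  have hpt : ∀ y z : EE d, ENNReal.ofReal (Nsing d p (x - (y + z))) ≤
      S.indicator (fun z => ENNReal.ofReal (Nsing d p ((x - y) - z))) z +
      S.indicator (fun y => ENNReal.ofReal (Nsing d p ((x - z) - y))) y := by
    intro y z
    have ea : x - y - z = x - (y + z) := by abel
    have eb : x - z - y = x - (y + z) := by abel
    by_cases hz : z ∈ S
    · rw [Set.indicator_of_mem hz, ea]; exact le_self_add
    by_cases hy : y ∈ S
    · rw [Set.indicator_of_mem hy, eb]; exact le_add_self
    have hz' : ‖z‖ < ‖x‖ / 4 := not_le.mp hz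
    have hy' : ‖y‖ < ‖x‖ / 4 := not_le.mp hy
    have : 1 ≤ ‖x - (y + z)‖ := by
      have g1 := norm_sub_norm_le x (y + z)
      have g2 := norm_add_le y z
      linarith
    simp [Nsing, not_lt.mpr this]
  have hm2 : Measurable (fun q : (EE d) × (EE d) =>
      S.indicator (fun y => ENNReal.ofReal (Nsing d p ((x - q.2) - y))) q.1) := by
    have : (fun q : (EE d) × (EE d) =>
      S.indicator (fun y => ENNReal.ofReal (Nsing d p ((x - q.2) - y))) q.1) =
      (Prod.fst ⁻¹' S).indicator (fun q => ENNReal.ofReal (Nsing d p ((x - q.2) - q.1))) := by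
      ext q; simp [Set.indicator]
    rw [this]
    refine Measurable.indicator ?_ (measurable_fst hSm)
    exact ((Nsing_meas d p).comp (by fun_prop)).ennreal_ofReal
  rw [muM, Measure.lintegral_conv hN]
  calc _ ≤ ∫⁻ y, ∫⁻ z, (S.indicator (fun z => ENNReal.ofReal (Nsing d p ((x - y) - z))) z +
      S.indicator (fun y => ENNReal.ofReal (Nsing d p ((x - z) - y))) y) ∂(nuM d φ ε)
        ∂(nuM d φ ε) := lintegral_mono fun y => lintegral_mono fun z => hpt y z
    _ = ∫⁻ y, ∫⁻ z, S.indicator (fun z => ENNReal.ofReal (Nsing d p ((x - y) - z))) z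
          ∂(nuM d φ ε) ∂(nuM d φ ε) +
        ∫⁻ y, ∫⁻ z, S.indicator (fun y => ENNReal.ofReal (Nsing d p ((x - z) - y))) y
          ∂(nuM d φ ε) ∂(nuM d φ ε) := by
        exact lint_split _ (fun y z => S.indicator
          (fun z => ENNReal.ofReal (Nsing d p ((x - y) - z))) z)
          (fun y z => S.indicator (fun y => ENNReal.ofReal (Nsing d p ((x - z) - y))) y) hm2
    _ ≤ ENNReal.ofReal b * n + ENNReal.ofReal b * n := by
        gcongr
        · refine (lintegral_mono fun y => key (x - y)).trans ?_
          simp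
        · rw [lintegral_lintegral_swap hm2.aemeasurable]
          refine (lintegral_mono fun y => key (x - y)).trans ?_
          simp
    _ = _ := by
        rw [← ENNReal.ofReal_toReal hnfin.ne, ← ENNReal.ofReal_mul (by positivity),
          ← ENNReal.ofReal_add (by positivity) (by positivity)]
        congr 1
        rw [ENNReal.toReal_ofReal (by positivity), hbdef]; ring
section

lemma mu_N_int (d : ℕ) (hd : 3 ≤ d) {p : ℝ} (hp1 : 2 - (d : ℝ) ≤ p)
    {φ : (EE d) → ℝ} (hφ : IsMollifier d φ) {ε : ℝ} (hε : 0 < ε) (x : EE d) : Integrable (fun w => Nsing d p (x - w)) (muM d φ ε) := by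
  obtain ⟨A, hA, h⟩ := mu_N_bdd d hφ hε hd hp1
  refine ⟨((Nsing_meas d p).comp (measurable_const.sub measurable_id)).aestronglyMeasurable, ?_⟩
  rw [hasFiniteIntegral_iff_ofReal (Eventually.of_forall fun w => Nsing_nonneg d p _)]
  exact (h x).trans_lt hA

lemma mu_K_int (d : ℕ) (hd : 3 ≤ d) {p q : ℝ} (hp1 : 2 - (d : ℝ) ≤ p) (hp2 : p < 0)
    (hq1 : 0 < q) (hq2 : q ≤ 2) {φ : (EE d) → ℝ} (hφ : IsMollifier d φ) {ε : ℝ} (hε : 0 < ε) (x : EE d) : Integrable (fun w => Kfun d p q (x - w)) (muM d φ ε) := by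
  have := mu_prob d hφ hε
  have hN := mu_N_int d hd hp1 hφ hε x
  have h3 := (mu_moment d hφ hε hd).1
  have hg : Integrable (fun w : EE d => (1 + 4 * (‖x‖ ^ 3 + ‖w‖ ^ 3)) / q +
      (1 + Nsing d p (x - w)) / (-p)) (muM d φ ε) :=
    (((integrable_const _).add (((integrable_const _).add h3).const_mul _)).div_const _).add
      (((integrable_const _).add hN).div_const _)
  refine hg.mono' ((Kfun_meas d p q).comp (measurable_const.sub measurable_id)).aestronglyMeasurable
    (Eventually.of_forall fun w => ?_)
  rw [Real.norm_of_nonneg (aux_Kfun_nonneg d hp2 hq1 _)]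
  refine (aux_Kfun_le d hp2 hq1 hq2 _).trans ?_
  have e : ‖x - w‖ ^ 3 ≤ 4 * (‖x‖ ^ 3 + ‖w‖ ^ 3) := by
    have h1 : ‖x - w‖ ^ 3 ≤ (‖x‖ + ‖w‖) ^ 3 := by gcongr; exact norm_sub_le _ _
    have ha := norm_nonneg x
    have hb := norm_nonneg w
    nlinarith [mul_nonneg (add_nonneg ha hb) (sq_nonneg (‖x‖ - ‖w‖))]
  gcongr

lemma Kreg_eq_s7 (d : ℕ) (hd : 3 ≤ d) {p q : ℝ} (hp1 : 2 - (d : ℝ) ≤ p) (hp2 : p < 0)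
    (hq1 : 0 < q) (hq2 : q ≤ 2) {φ : (EE d) → ℝ} (hφ : IsMollifier d φ) {ε : ℝ} (hε : 0 < ε) (x : EE d) : Kreg d p q φ ε x = ∫ w, Kfun d p q (x - w) ∂(muM d φ ε) := by
  have := nu_prob d hφ hε
  have hI := mu_K_int d hd hp1 hp2 hq1 hq2 hφ hε x
  have hn : ∀ f : (EE d) → ℝ, ∫ y, f y ∂(nuM d φ ε) = ∫ y, scaled d φ ε y * f y := by
    intro f
    rw [nuM, integral_withDensity_eq_integral_toReal_smul (scaled_meas d hφ) (by simp)]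
    refine integral_congr_ae (Eventually.of_forall fun y => ?_)
    simp [ENNReal.toReal_ofReal (scaled_nonneg d hφ hε y)]
  unfold muM at hI ⊢
  rw [integral_conv hI, hn]
  unfold Kreg
  refine integral_congr_ae (Eventually.of_forall fun y => ?_)
  simp only []
  rw [hn, ← integral_const_mul]
  refine integral_congr_ae (Eventually.of_forall fun z => ?_)
  simp only [sub_sub]
  ring

lemma mu_ae_ne (d : ℕ) (hd : 3 ≤ d) {φ : (EE d) → ℝ}
    (hφ : IsMollifier d φ) {ε : ℝ} (hε : 0 < ε) (x : EE d) : ∀ᵐ w ∂(muM d φ ε), x - w ≠ 0 := by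
  have : NeZero d := ⟨by omega⟩
  refine (mu_ac d hφ hε).ae_le ?_
  have h : ∀ᵐ w : EE d, w ≠ x := by simp [ae_iff]
  filter_upwards [h] with w hw
  exact sub_ne_zero.mpr (Ne.symm hw)

lemma Kreg_ge_of_one_le (d : ℕ) (hd : 3 ≤ d) {p q : ℝ} (hp1 : 2 - (d : ℝ) ≤ p) (hp2 : p < 0)
    (hq1 : 0 < q) (hq2 : q ≤ 2) {φ : (EE d) → ℝ} (hφ : IsMollifier d φ) {ε : ℝ} (hε : 0 < ε) (x : EE d) (hx : 1 ≤ ‖x‖) : Kfun d p q x ≤ Kreg d p q φ ε x := by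
  have := mu_prob d hφ hε
  have hI := mu_K_int d hd hp1 hp2 hq1 hq2 hφ hε x
  have hx0 : x ≠ 0 := norm_pos_iff.mp (by linarith)
  have hL : Integrable (fun w => Real.log ‖x - w‖) (muM d φ ε) := by
    refine hI.mono' (Real.measurable_log.comp
      (measurable_norm.comp (measurable_const.sub measurable_id))).aestronglyMeasurable
      (Eventually.of_forall fun w => aux_abs_log_le d hp2 hq1 _)
  have h1 := aux_log_average d (by omega) (muM d φ ε) (mu_inv d hφ hε) x hx0 hL
  have hs : 0 ≤ ‖x‖ ^ q - ‖x‖ ^ p :=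
    sub_nonneg.mpr (Real.rpow_le_rpow_of_exponent_le hx (by linarith))
  rw [Kreg_eq_s7 d hd hp1 hp2 hq1 hq2 hφ hε]
  have h2 : ∫ w, (Kfun d p q x + (‖x‖ ^ q - ‖x‖ ^ p) * (Real.log ‖x - w‖ - Real.log ‖x‖))
      ∂(muM d φ ε) ≤ ∫ w, Kfun d p q (x - w) ∂(muM d φ ε) := by
    refine integral_mono_ae ((integrable_const _).add ((hL.sub (integrable_const _)).const_mul _))
      hI ?_
    filter_upwards [mu_ae_ne d hd hφ hε x] with w hw
    exact aux_tangent d hp2 hq1 hx0 hw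
  have hL2 : Integrable (fun w => (‖x‖ ^ q - ‖x‖ ^ p) * (Real.log ‖x - w‖ - Real.log ‖x‖))
      (muM d φ ε) := (hL.sub (integrable_const _)).const_mul _
  rw [integral_add (integrable_const _) hL2,
    integral_const_mul, integral_sub hL (integrable_const _)] at h2
  simp only [integral_const, probReal_univ, one_smul] at h2
  have := mul_nonneg hs (sub_nonneg.mpr h1)
  linarith

lemma Kreg_ge_unit (d : ℕ) (hd : 3 ≤ d) {p q : ℝ} (hp1 : 2 - (d : ℝ) ≤ p) (hp2 : p < 0)
    (hq1 : 0 < q) (hq2 : q ≤ 2) {φ : (EE d) → ℝ} (hφ : IsMollifier d φ) {ε : ℝ} (hε : 0 < ε) (x e : EE d) (he : ‖e‖ = 1) : Kfun d p q e ≤ Kreg d p q φ ε x := by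
  have := mu_prob d hφ hε
  have hI := mu_K_int d hd hp1 hp2 hq1 hq2 hφ hε x
  have he0 : e ≠ 0 := norm_pos_iff.mp (by rw [he]; norm_num)
  rw [Kreg_eq_s7 d hd hp1 hp2 hq1 hq2 hφ hε]
  have h2 : ∫ w, Kfun d p q e ∂(muM d φ ε) ≤ ∫ w, Kfun d p q (x - w) ∂(muM d φ ε) := by
    refine integral_mono_ae (integrable_const _) hI ?_
    filter_upwards [mu_ae_ne d hd hφ hε x] with w hw
    have := aux_tangent d hp2 hq1 he0 hw
    simpa [he] using this
  simpa using h2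

lemma part_a (d : ℕ) (hd : 3 ≤ d) {p q : ℝ} (hp1 : 2 - (d : ℝ) ≤ p) (hp2 : p < 0)
    (hq1 : 0 < q) (hq2 : q ≤ 2) {φ : (EE d) → ℝ} (hφ : IsMollifier d φ) {ε : ℝ} (hε : 0 < ε) (x : EE d) :
    sInf (Kfun d p q '' {z : EE d | ‖x‖ / 2 ≤ ‖z‖}) ≤ Kreg d p q φ ε x := by
  have hb : BddBelow (Kfun d p q '' {z : EE d | ‖x‖ / 2 ≤ ‖z‖}) :=
    ⟨0, by rintro _ ⟨z, _, rfl⟩; exact aux_Kfun_nonneg d hp2 hq1 z⟩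
  rcases le_total 1 ‖x‖ with h | h
  · refine (csInf_le hb ⟨x, ?_, rfl⟩).trans (Kreg_ge_of_one_le d hd hp1 hp2 hq1 hq2 hφ hε x h)
    show ‖x‖ / 2 ≤ ‖x‖
    linarith
  · have he : ‖EuclideanSpace.single (⟨0, by omega⟩ : Fin d) (1 : ℝ)‖ = 1 := by simp
    refine (csInf_le hb ⟨_, ?_, rfl⟩).trans (Kreg_ge_unit d hd hp1 hp2 hq1 hq2 hφ hε x _ he)
    show ‖x‖ / 2 ≤ _
    rw [he]; linarith

lemma part_a2 (d : ℕ) (hd : 3 ≤ d) {p q : ℝ} (hp1 : 2 - (d : ℝ) ≤ p) (hp2 : p < 0)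
    (hq1 : 0 < q) (hq2 : q ≤ 2) {φ : (EE d) → ℝ} (hφ : IsMollifier d φ) {ε : ℝ} (hε : 0 < ε) : Tendsto (Kreg d p q φ ε) (comap (fun x : EE d => ‖x‖) atTop) atTop := by
  have h1 : Tendsto (fun x : EE d => ‖x‖ ^ q / q) (comap (fun x : EE d => ‖x‖) atTop) atTop :=
    ((tendsto_rpow_atTop hq1).atTop_div_const hq1).comp tendsto_comap
  refine tendsto_atTop_mono' _ ?_ h1
  filter_upwards [tendsto_comap.eventually (eventually_ge_atTop (1 : ℝ))] with x hx
  refine le_trans ?_ (Kreg_ge_of_one_le d hd hp1 hp2 hq1 hq2 hφ hε x hx)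
  unfold Kfun
  have : ‖x‖ ^ p / p ≤ 0 := div_nonpos_of_nonneg_of_nonpos (by positivity) hp2.le
  linarith
end

/-- The lower bound for the derivative integrand. -/
def Lfun (d : ℕ) (p q : ℝ) (x w : EE d) : ℝ :=
  ‖x‖ ^ (q - 2) * (c1 p q - (8 * c1 p q + 4) * ‖w‖ ^ 3) - Nsing d p (x - w)

section

lemma mu_ae_line (d : ℕ) (hd : 3 ≤ d) {φ : (EE d) → ℝ}
    (hφ : IsMollifier d φ) {ε : ℝ} (hε : 0 < ε) (i : Fin d) (x : EE d) :
    ∀ᵐ w ∂(muM d φ ε), ∀ s : ℝ, (x - w) + s • EuclideanSpace.single i (1 : ℝ) ≠ 0 := by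
  refine (mu_ac d hφ hε).ae_le ?_
  set P : AffineSubspace ℝ (EE d) :=
    AffineSubspace.mk' x (Submodule.span ℝ {EuclideanSpace.single i (1 : ℝ)}) with hP
  have hne : P ≠ ⊤ := by
    intro h
    have h2 : P.direction = ⊤ := by rw [h, AffineSubspace.direction_top]
    rw [hP, AffineSubspace.direction_mk'] at h2
    have h3 := finrank_span_le_card (R := ℝ) ({EuclideanSpace.single i (1 : ℝ)} : Set (EE d))
    rw [h2, finrank_top, finrank_euclideanSpace_fin] at h3
    simp at h3
    omega
  have h0 := Measure.addHaar_affineSubspace (volume : Measure (EE d)) P hne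
  have h1 : ∀ᵐ w : EE d, w ∉ (P : Set (EE d)) := measure_eq_zero_iff_ae_notMem.mp h0
  filter_upwards [h1] with w hw s hs
  apply hw
  show w ∈ P
  rw [hP, AffineSubspace.mem_mk', vsub_eq_sub, Submodule.mem_span_singleton]
  refine ⟨s, ?_⟩
  have : w - x = -(x - w) := by abel
  rw [this]
  exact (neg_eq_of_add_eq_zero_right hs).symm

lemma two_lt_norm {d : ℕ} (i : Fin d) (x : EE d) (hx : 2 < x i) : 2 < ‖x‖ :=
  hx.trans_le ((le_abs_self _).trans (PiLp.norm_apply_le x i))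

lemma mean_L (d : ℕ) (hd : 3 ≤ d) {p q : ℝ} (hp1 : 2 - (d : ℝ) ≤ p)
    (hp2 : p < 0) (hq1 : 0 < q) (hq2 : q ≤ 2) {φ : (EE d) → ℝ} (hφ : IsMollifier d φ) : ∃ ε₀ : ℝ, 0 < ε₀ ∧ ∀ ε : ℝ, 0 < ε → ε < ε₀ → ∀ i : Fin d, ∀ x : EE d, 2 < x i →
    0 ≤ ∫ w, Lfun d p q x w ∂(muM d φ ε) := by
  obtain ⟨A, hA, hN⟩ := mu_N_tail d hd hp1 hφ
  have hc := c1_pos hp2 hq1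
  set c := c1 p q with hcdef
  set M := ∫ y, ‖y‖ ^ 3 * φ y with hM
  have hM0 : 0 ≤ M := integral_nonneg fun y => mul_nonneg (by positivity) (hφ.2.2.1 y)
  set D := 8 * (8 * c + 4) * M + A + 1 with hD
  have hD0 : 0 < D := by positivity
  refine ⟨min 1 (c / D), by positivity, fun ε hε hε0 i x hx => ?_⟩
  have := mu_prob d hφ hε
  have hε1 : ε ≤ 1 := (hε0.trans_le (min_le_left _ _)).le
  have hεD : ε * D ≤ c := by
    have := (hε0.trans_le (min_le_right _ _)).le
    rwa [le_div_iff₀ hD0] at this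
  have hx2 := two_lt_norm i x hx
  obtain ⟨h3, h3'⟩ := mu_moment d hφ hε hd
  have hNi := mu_N_int d hd hp1 hφ hε x
  have hNb : ∫ w, Nsing d p (x - w) ∂(muM d φ ε) ≤ A * ε * ‖x‖ ^ (-2 : ℝ) := by
    rw [integral_eq_lintegral_of_nonneg_ae (Eventually.of_forall fun w => Nsing_nonneg d p _)
      hNi.aestronglyMeasurable]
    exact ENNReal.toReal_le_of_le_ofReal (by positivity) (hN ε hε hε1 x hx2.le)
  have hpow : ‖x‖ ^ (-2 : ℝ) ≤ ‖x‖ ^ (q - 2) :=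
    Real.rpow_le_rpow_of_exponent_le (by linarith) (by linarith)
  have hN2 : ∫ w, Nsing d p (x - w) ∂(muM d φ ε) ≤ A * ε * ‖x‖ ^ (q - 2) :=
    hNb.trans (by gcongr)
  have hE : ∫ w, Lfun d p q x w ∂(muM d φ ε) =
      ‖x‖ ^ (q - 2) * (c - (8 * c + 4) * ∫ w, ‖w‖ ^ 3 ∂(muM d φ ε)) -
        ∫ w, Nsing d p (x - w) ∂(muM d φ ε) := by
    have i1 : Integrable (fun w : EE d => (8 * c + 4) * ‖w‖ ^ 3) (muM d φ ε) := h3.const_mul _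
    have i2 : Integrable (fun w : EE d => c - (8 * c + 4) * ‖w‖ ^ 3) (muM d φ ε) :=
      (integrable_const _).sub i1
    have i3 : Integrable (fun w : EE d => ‖x‖ ^ (q - 2) * (c - (8 * c + 4) * ‖w‖ ^ 3))
      (muM d φ ε) := i2.const_mul _
    unfold Lfun
    rw [← hcdef, integral_sub i3 hNi, integral_const_mul, integral_sub (integrable_const _) i1,
      integral_const_mul]
    simp
  rw [hE]
  have hε3 : ε ^ 3 ≤ ε := by
    have : ε ^ 3 ≤ ε ^ 1 := pow_le_pow_of_le_one hε.le hε1 (by norm_num)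
    simpa using this
  have h4 : ∫ w, ‖w‖ ^ 3 ∂(muM d φ ε) ≤ 8 * ε * M := by
    have g1 : ∫ w, ‖w‖ ^ 3 ∂(muM d φ ε) ≤ 8 * ε ^ 3 * M := h3'
    have g2 : 8 * ε ^ 3 * M ≤ 8 * ε * M :=
      mul_le_mul_of_nonneg_right (by linarith) hM0
    exact g1.trans g2
  have h5 : A * ε ≤ c - (8 * c + 4) * ∫ w, ‖w‖ ^ 3 ∂(muM d φ ε) := by
    have := mul_le_mul_of_nonneg_left h4 (by positivity : 0 ≤ 8 * c + 4)
    rw [hD] at hεD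
    nlinarith
  have h6 := mul_le_mul_of_nonneg_left h5 (by positivity : 0 ≤ ‖x‖ ^ (q - 2))
  nlinarith

lemma Lfun_le (d : ℕ) {p q : ℝ} (hp2 : p < 0) (hq1 : 0 < q) (hq2 : q ≤ 2) (x w : EE d)
    (hx : 1 ≤ ‖x‖) :
    |Lfun d p q x w| ≤ (c1 p q + (8 * c1 p q + 4) * ‖w‖ ^ 3) + Nsing d p (x - w) := by
  have hc := c1_pos hp2 hq1
  have hN := Nsing_nonneg d p (x - w)
  have h1 : ‖x‖ ^ (q - 2) ≤ 1 := Real.rpow_le_one_of_one_le_of_nonpos hx (by linarith)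
  have h0 : 0 ≤ ‖x‖ ^ (q - 2) := by positivity
  have hw : 0 ≤ (8 * c1 p q + 4) * ‖w‖ ^ 3 := by positivity
  unfold Lfun
  rw [abs_le]
  constructor <;> nlinarith

lemma L_joint (d : ℕ) (hd : 3 ≤ d) {p q : ℝ} (hp1 : 2 - (d : ℝ) ≤ p) (hp2 : p < 0)
    (hq1 : 0 < q) (hq2 : q ≤ 2) {φ : (EE d) → ℝ} (hφ : IsMollifier d φ) {ε : ℝ} (hε : 0 < ε) (i : Fin d) (x : EE d) (hx : 2 < x i) (t : ℝ) :
    Integrable (fun r : ℝ × (EE d) => Lfun d p q (x + r.1 • EuclideanSpace.single i (1 : ℝ)) r.2)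
      ((volume.restrict (Set.Ioc 0 t)).prod (muM d φ ε)) := by
  have := mu_prob d hφ hε
  obtain ⟨A, hA, hN⟩ := mu_N_bdd d hφ hε hd hp1
  have hm : Measurable (fun r : ℝ × (EE d) => x + r.1 • EuclideanSpace.single i (1 : ℝ)) := by
    fun_prop
  have hmN : Measurable (fun r : ℝ × (EE d) =>
      Nsing d p (x + r.1 • EuclideanSpace.single i (1 : ℝ) - r.2)) :=
    (Nsing_meas d p).comp (hm.sub measurable_snd)
  have hmL : Measurable (fun r : ℝ × (EE d) =>
      Lfun d p q (x + r.1 • EuclideanSpace.single i (1 : ℝ)) r.2) := by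
    unfold Lfun
    refine Measurable.sub (Measurable.mul (hm.norm.pow_const _) ?_) hmN
    fun_prop
  have iN : Integrable (fun r : ℝ × (EE d) =>
      Nsing d p (x + r.1 • EuclideanSpace.single i (1 : ℝ) - r.2))
      ((volume.restrict (Set.Ioc 0 t)).prod (muM d φ ε)) := by
    refine ⟨hmN.aestronglyMeasurable, ?_⟩
    rw [hasFiniteIntegral_iff_ofReal (Eventually.of_forall fun w => Nsing_nonneg d p _),
      lintegral_prod _ hmN.ennreal_ofReal.aemeasurable]
    have hle : ∫⁻ s : ℝ, (∫⁻ w, ENNReal.ofReal (Nsing d p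
        (x + s • EuclideanSpace.single i (1 : ℝ) - w)) ∂(muM d φ ε)) ∂(volume.restrict (Set.Ioc 0 t))
        ≤ ∫⁻ _ : ℝ, A ∂(volume.restrict (Set.Ioc 0 t)) :=
      lintegral_mono fun s => hN (x + s • EuclideanSpace.single i (1 : ℝ))
    refine lt_of_le_of_lt hle ?_
    rw [lintegral_const]
    exact ENNReal.mul_lt_top hA (measure_lt_top _ _)
  have i3 : Integrable (fun w : EE d => c1 p q + (8 * c1 p q + 4) * ‖w‖ ^ 3) (muM d φ ε) :=
    (integrable_const _).add ((mu_moment d hφ hε hd).1.const_mul _)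
  have i4 : Integrable (fun r : ℝ × (EE d) => c1 p q + (8 * c1 p q + 4) * ‖r.2‖ ^ 3)
      ((volume.restrict (Set.Ioc 0 t)).prod (muM d φ ε)) := i3.comp_snd _
  refine (i4.add iN).mono' hmL.aestronglyMeasurable ?_
  have hae : ∀ᵐ r ∂((volume.restrict (Set.Ioc 0 t)).prod (muM d φ ε)), r.1 ∈ Set.Ioc 0 t :=
    Measure.quasiMeasurePreserving_fst.ae (ae_restrict_mem measurableSet_Ioc)
  filter_upwards [hae] with r hr
  refine Lfun_le d hp2 hq1 hq2 _ _ ?_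
  have : 2 < (x + r.1 • EuclideanSpace.single i (1 : ℝ)) i := by
    simp; linarith [hr.1]
  linarith [two_lt_norm i _ this]

lemma line_ftc (d : ℕ) {p q : ℝ} (hp2 : p < 0) (hq1 : 0 < q) (hq2 : q ≤ 2) (i : Fin d)
    (x w : EE d) (hx : 2 < x i) (t : ℝ) (ht : 0 ≤ t)
    (hne : ∀ s : ℝ, (x - w) + s • EuclideanSpace.single i (1 : ℝ) ≠ 0)
    (hL : Integrable (fun s : ℝ => Lfun d p q (x + s • EuclideanSpace.single i (1 : ℝ)) w)
      (volume.restrict (Set.Ioc 0 t))) :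
    ∫ s, Lfun d p q (x + s • EuclideanSpace.single i (1 : ℝ)) w ∂(volume.restrict (Set.Ioc 0 t))
      ≤ Kfun d p q (x + t • EuclideanSpace.single i (1 : ℝ) - w) - Kfun d p q (x - w) := by
  have hc : Continuous (fun s : ℝ => hder d p q i
      ((x - w) + s • EuclideanSpace.single i (1 : ℝ))) := by
    have h0 : Continuous (fun s : ℝ => (x - w) + s • EuclideanSpace.single i (1 : ℝ)) := by
      fun_prop
    have h1 : ∀ s : ℝ, ‖(x - w) + s • EuclideanSpace.single i (1 : ℝ)‖ ≠ 0 :=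
      fun s => norm_ne_zero_iff.mpr (hne s)
    unfold hder
    refine Continuous.mul (by fun_prop) (Continuous.sub ?_ ?_)
    · exact h0.norm.rpow_const fun s => Or.inl (h1 s)
    · exact h0.norm.rpow_const fun s => Or.inl (h1 s)
  have hftc := intervalIntegral.integral_eq_sub_of_hasDerivAt (a := 0) (b := t)
    (fun s _ => aux_hasDeriv d hp2 hq1 i (x - w) s (hne s)) (hc.intervalIntegrable 0 t)
  have e : ∀ s : ℝ, (x - w) + s • EuclideanSpace.single i (1 : ℝ) =
      x + s • EuclideanSpace.single i (1 : ℝ) - w := fun s => by abel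
  rw [zero_smul, add_zero, e t, intervalIntegral.integral_of_le ht] at hftc
  rw [← hftc]
  refine integral_mono_ae hL (hc.intervalIntegrable 0 t).1 ?_
  filter_upwards [ae_restrict_mem measurableSet_Ioc] with s hs
  have h2 : 2 < (x + s • EuclideanSpace.single i (1 : ℝ)) i := by
    simp; linarith [hs.1]
  have h3 := hne s
  rw [e s] at h3
  simp only [e s]
  exact aux_hder_lower d hp2 hq1 hq2 i _ w h2 h3

lemma part_b_mono (d : ℕ) (hd : 3 ≤ d) {p q : ℝ} (hp1 : 2 - (d : ℝ) ≤ p) (hp2 : p < 0)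
    (hq1 : 0 < q) (hq2 : q ≤ 2) {φ : (EE d) → ℝ} (hφ : IsMollifier d φ) {ε : ℝ} (hε : 0 < ε) (i : Fin d) (hmean : ∀ x : EE d, 2 < x i → 0 ≤ ∫ w, Lfun d p q x w ∂(muM d φ ε))
    (x : EE d) (hx : 2 < x i) (t : ℝ) (ht : 0 ≤ t) :
    Kreg d p q φ ε x ≤ Kreg d p q φ ε (x + t • EuclideanSpace.single i (1 : ℝ)) := by
  have := mu_prob d hφ hε
  have hJ := L_joint d hd hp1 hp2 hq1 hq2 hφ hε i x hx t
  have hK0 := mu_K_int d hd hp1 hp2 hq1 hq2 hφ hε x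
  have hK1 := mu_K_int d hd hp1 hp2 hq1 hq2 hφ hε (x + t • EuclideanSpace.single i (1 : ℝ))
  rw [Kreg_eq_s7 d hd hp1 hp2 hq1 hq2 hφ hε, Kreg_eq_s7 d hd hp1 hp2 hq1 hq2 hφ hε, ← sub_nonneg,
    ← integral_sub hK1 hK0]
  have h1 : 0 ≤ ∫ w, ∫ s, Lfun d p q (x + s • EuclideanSpace.single i (1 : ℝ)) w
      ∂(volume.restrict (Set.Ioc 0 t)) ∂(muM d φ ε) := by
    rw [← integral_integral_swap (f := fun s w => Lfun d p q
      (x + s • EuclideanSpace.single i (1 : ℝ)) w) hJ]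
    refine integral_nonneg_of_ae ?_
    filter_upwards [ae_restrict_mem measurableSet_Ioc] with s hs
    refine hmean _ ?_
    simp; linarith [hs.1]
  refine h1.trans (integral_mono_ae hJ.integral_prod_right (hK1.sub hK0) ?_)
  filter_upwards [mu_ae_line d hd hφ hε i x, hJ.prod_left_ae] with w hw hi
  exact line_ftc d hp2 hq1 hq2 i x w hx t ht hw hi
end

lemma fderiv_nonneg_of_mono (d : ℕ) (f : (EE d) → ℝ) (x e : EE d)
    (h : ∀ t : ℝ, 0 ≤ t → f x ≤ f (x + t • e)) : 0 ≤ fderiv ℝ f x e := by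
  by_cases hf : DifferentiableAt ℝ f x
  · have h1 : HasDerivAt (fun t : ℝ => f (x + t • e)) (fderiv ℝ f x e) 0 := by
      have h2 : HasDerivAt (fun t : ℝ => x + t • e) e 0 := by
        simpa using ((hasDerivAt_id (0 : ℝ)).smul_const e).const_add x
      have h3 : HasFDerivAt f (fderiv ℝ f x) (x + (0 : ℝ) • e) := by simpa using hf.hasFDerivAt
      exact h3.comp_hasDerivAt (0 : ℝ) h2
    have h4 := (hasDerivAt_iff_tendsto_slope.mp h1).mono_left
      (nhdsWithin_mono (0 : ℝ) (fun t (ht : t ∈ Set.Ioi (0 : ℝ)) => ne_of_gt ht))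
    refine ge_of_tendsto h4 ?_
    filter_upwards [self_mem_nhdsWithin] with t ht
    have ht' : (0 : ℝ) < t := ht
    rw [slope_def_field]
    have := h t ht'.le
    simp only [zero_smul, add_zero, sub_zero]
    exact div_nonneg (by linarith) ht'.le
  · rw [fderiv_zero_of_not_differentiableAt hf]; simp

/-- Coercivity of the regularized kernels, and eventual coordinatewise
monotonicity. -/
theorem regularized_kernel_coercive_and_increasing
    (d : ℕ) (hd : 3 ≤ d) (p q : ℝ) (hp1 : 2 - (d : ℝ) ≤ p) (hp2 : p < 0)
    (hq1 : 0 < q) (hq2 : q ≤ 2)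
    (φ : EuclideanSpace ℝ (Fin d) → ℝ) (hφ : IsMollifier d φ) :
    (∀ ε : ℝ, 0 < ε → ∀ x : EuclideanSpace ℝ (Fin d),
        sInf (Kfun d p q '' {z : EuclideanSpace ℝ (Fin d) | ‖x‖ / 2 ≤ ‖z‖})
          ≤ Kreg d p q φ ε x) ∧
    (∀ ε : ℝ, 0 < ε →
        Tendsto (Kreg d p q φ ε)
          (comap (fun x : EuclideanSpace ℝ (Fin d) => ‖x‖) atTop) atTop) ∧
    (∃ ε₀ : ℝ, 0 < ε₀ ∧ ∀ ε : ℝ, 0 < ε → ε < ε₀ → ∀ i : Fin d,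
      ∀ x : EuclideanSpace ℝ (Fin d), 2 < x i →
        0 ≤ fderiv ℝ (Kreg d p q φ ε) x (EuclideanSpace.single i 1) ∧
        ∀ t : ℝ, 0 ≤ t →
          Kreg d p q φ ε x ≤ Kreg d p q φ ε (x + t • EuclideanSpace.single i 1)) := by
  refine ⟨fun ε hε x => part_a d hd hp1 hp2 hq1 hq2 hφ hε x,
    fun ε hε => part_a2 d hd hp1 hp2 hq1 hq2 hφ hε, ?_⟩
  obtain ⟨ε₀, h0, h⟩ := mean_L d hd hp1 hp2 hq1 hq2 hφ
  refine ⟨ε₀, h0, fun ε hε hε0 i x hx => ?_⟩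
  have hm := part_b_mono d hd hp1 hp2 hq1 hq2 hφ hε i (h ε hε hε0 i) x hx
  exact ⟨fderiv_nonneg_of_mono d _ x _ hm, hm⟩
end
end
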